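/- Let u be a weak supersolution of ∂ₜu + 𝓛u = Δu in Ω × (0,T) with u ≥ 0 on B_R(x₀) × (t₀, t₀ + r²), where B_R(x₀) × (t₀, t₀ + r²) ⊂ Ω × (0,T), 0 < r ≤ 1 and r < R/2. Let d > 0 and set w = u + l with l ≥ (r/R)² · Tail_∞(u₋; x₀, R, t₀, t₀ + r²) + d. Set κ = 2N/(N − 2) if N > 2 and κ = 4 if N = 2, and let γ = 2 − 2/κ. Then for every q with 0 < q < γ there exist constants C > 0 depending only on N, s, Λ, q and θ > 0 depending only on N such that for all q̄ with 0 < q̄ < q and all σ', σ with 1/2 ≤ σ' < σ ≤ 1 one has ( ⨍_{U⁺(σ'r)} w^q dx dt )^{1/q} ≤ ( C (σ − σ')^{−θ} )^{1/q̄} · ( ⨍_{U⁺(σr)} w^{q̄} dx dt )^{1/q̄}, where U⁺(ηr) = B_{ηr}(x₀) × (t₀, t₀ + (ηr)²) for 1/2 ≤ η ≤ 1. -/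

import Mathlib

open MeasureTheory Metric Set
open scoped RealInnerProductSpace ENNReal

noncomputable section

/-- Euclidean space `ℝ^N`. -/
abbrev E (N : ℕ) : Type := EuclideanSpace ℝ (Fin N)

/-- The kernel `K` is measurable, symmetric in its first two arguments, and comparable to
the fractional kernel `|x-y|^{-(N+2s)}` with constant `Λ`, uniformly for `t ∈ (0,T)`. -/
def KernelOK (N : ℕ) (s Λ T : ℝ) (K : E N → E N → ℝ → ℝ) : Prop :=
  Measurable (fun p : E N × E N × ℝ => K p.1 p.2.1 p.2.2) ∧
  (∀ x y t, K x y t = K y x t) ∧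
  ∀ x y : E N, x ≠ y → ∀ t ∈ Set.Ioo 0 T,
    Λ⁻¹ * ‖x - y‖ ^ (-((N : ℝ) + 2 * s)) ≤ K x y t ∧
      K x y t ≤ Λ * ‖x - y‖ ^ (-((N : ℝ) + 2 * s))

/-- `u` is a (bounded, measurable, smooth in `Ω × (0,T)`) weak supersolution of
`∂ₜ u + 𝓛 u = Δ u` in `Ω × (0,T)`. -/
def IsWeakSupersolution (N : ℕ) (T : ℝ) (K : E N → E N → ℝ → ℝ)
    (Ω : Set (E N)) (u : E N → ℝ → ℝ) : Prop :=
  Measurable (fun p : E N × ℝ => u p.1 p.2) ∧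
  (∃ M : ℝ, ∀ x t, t ∈ Set.Ioo 0 T → |u x t| ≤ M) ∧
  ContDiffOn ℝ (⊤ : ℕ∞) (fun p : E N × ℝ => u p.1 p.2) (Ω ×ˢ Set.Ioo 0 T) ∧
  ∀ φ : E N → ℝ → ℝ,
    ContDiff ℝ (⊤ : ℕ∞) (fun p : E N × ℝ => φ p.1 p.2) →
    HasCompactSupport (fun p : E N × ℝ => φ p.1 p.2) →
    tsupport (fun p : E N × ℝ => φ p.1 p.2) ⊆ Ω ×ˢ Set.Ioo 0 T →
    (∀ x t, 0 ≤ φ x t) →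
    0 ≤ -(∫ t in Set.Ioo 0 T, ∫ x in Ω, u x t * deriv (fun τ => φ x τ) t) +
        (∫ t in Set.Ioo 0 T, ∫ x in Ω,
          ⟪gradient (fun y => u y t) x, gradient (fun y => φ y t) x⟫) +
        ∫ t in Set.Ioo 0 T, ∫ x : E N, ∫ y : E N,
          (u x t - u y t) * (φ x t - φ y t) * K x y t

/-- The negative part `u₋ = max(-u, 0)`. -/
def uminus (N : ℕ) (u : E N → ℝ → ℝ) : E N → ℝ → ℝ := fun x t => max (-(u x t)) 0

/-- The parabolic tail `Tail_∞(w; x₀, ρ, t₁, t₂)`. -/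
def tailInfty (N : ℕ) (s : ℝ) (w : E N → ℝ → ℝ) (x₀ : E N) (ρ t₁ t₂ : ℝ) : ℝ :=
  ρ ^ 2 * essSup
      (fun t => ∫ y in (Metric.ball x₀ ρ)ᶜ, |w y t| * ‖y - x₀‖ ^ (-((N : ℝ) + 2 * s)))
      (volume.restrict (Set.Ioo t₁ t₂))

/-- The Sobolev exponent: `κ = 2N/(N-2)` for `N > 2` and `κ = 4` for `N = 2`. -/
def kappa (N : ℕ) : ℝ := if 2 < N then 2 * N / ((N : ℝ) - 2) else 4

theorem aux_integral_le {α : Type*} [MeasurableSpace α] {μ : Measure α} {f g : α → ℝ}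
    (hfg : f ≤ᵐ[μ] g) (hg0 : 0 ≤ᵐ[μ] g) (hg : Integrable g μ) :
    ∫ x, f x ∂μ ≤ ∫ x, g x ∂μ := by
  by_cases hf : Integrable f μ
  · exact integral_mono_ae hf hg hfg
  · rw [integral_undef hf]
    exact integral_nonneg_of_ae hg0

theorem aux_alg_le {a b p y z : ℝ} (hb : 0 < b) (hab : b ≤ a) (hp0 : 0 < p) (hp1 : p < 1) :
    (a - b) * (a ^ (p - 1) * y ^ 2 - b ^ (p - 1) * z ^ 2) ≤
      (1 - p)⁻¹ * a ^ p * (y - z) ^ 2 := by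
  have ha : 0 < a := lt_of_lt_of_le hb hab
  have hA : 0 < a ^ (p - 1) := Real.rpow_pos_of_pos ha _
  have hB : 0 < b ^ (p - 1) := Real.rpow_pos_of_pos hb _
  have hAa : a ^ p = a ^ (p - 1) * a := by
    rw [← Real.rpow_add_one ha.ne']; congr 1; ring
  -- key: (a-b) * b^(p-1) ... use  (1-p)(a-b) A ≤ a... (B - A)
  have key : (1 - p) * (a - b) * b ^ (p - 1) ≤ a * (b ^ (p - 1) - a ^ (p - 1)) := by
    have h1 : (b / a) ^ (1 - p) ≤ 1 + (1 - p) * (b / a - 1) := by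
      have := rpow_one_add_le_one_add_mul_self (s := b / a - 1) (p := 1 - p)
        (by have : 0 < b / a := by positivity
            linarith) (by linarith) (by linarith)
      simpa using this
    have h2 : (b / a) ^ (1 - p) * b ^ (p - 1) = a ^ (p - 1) := by
      rw [Real.div_rpow hb.le ha.le, div_mul_eq_mul_div, ← Real.rpow_add hb]
      rw [show (1 - p + (p - 1)) = 0 by ring, Real.rpow_zero, one_div, ← Real.rpow_neg ha.le]
      congr 1; ring
    have h3 := mul_le_mul_of_nonneg_right h1 hB.le
    rw [h2] at h3
    have h4 := mul_le_mul_of_nonneg_left h3 ha.le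
    have h5 : a * ((1 + (1 - p) * (b / a - 1)) * b ^ (p - 1)) =
      a * b ^ (p - 1) + (1 - p) * (b - a) * b ^ (p - 1) := by
      field_simp
    nlinarith
  rw [hAa]
  have hq : 0 < 1 - p := by linarith
  rw [mul_assoc, inv_mul_eq_div, le_div_iff₀ hq]
  generalize a ^ (p - 1) = A at *
  generalize b ^ (p - 1) = B at *
  have hAB : A ≤ B := by
    by_contra h
    push Not at h
    have : (1 - p) * (a - b) * B ≥ 0 := by
      have : 0 ≤ a - b := by linarith
      positivity
    nlinarith
  -- (a-b)(A y² - B z²)(1-p) ≤ A a (y-z)²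
  rcases eq_or_lt_of_le hab with h | h
  · subst h
    have : 0 ≤ A * b * (y - z) ^ 2 := by positivity
    nlinarith
  have hd : 0 < a - b := by linarith
  have hAB' : A < B := by
    by_contra hh
    have hh : A = B := le_antisymm hAB (not_lt.1 hh)
    have : 0 < (1 - p) * (a - b) * B := by positivity
    rw [hh] at key; linarith
  -- let D = (1-p)(a-b) ; D*B ≤ a (B-A)
  have hD : 0 < (1 - p) * (a - b) := by positivity
  generalize hDD : (1 - p) * (a - b) = D at *
  have e : (a - b) * (A * y ^ 2 - B * z ^ 2) * (1 - p) = D * (A * y ^ 2 - B * z ^ 2) := by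
    rw [← hDD]; ring
  rw [e]
  -- multiply by (B - A)
  have h6 : (A * y ^ 2 - B * z ^ 2) * (B - A) ≤ A * B * (y - z) ^ 2 := by
    nlinarith [sq_nonneg (A * y - B * z)]
  have h7 : D * (A * y ^ 2 - B * z ^ 2) * (B - A) ≤ A * a * (y - z) ^ 2 * (B - A) := by
    calc D * (A * y ^ 2 - B * z ^ 2) * (B - A) = D * ((A * y ^ 2 - B * z ^ 2) * (B - A)) := by ring
      _ ≤ D * (A * B * (y - z) ^ 2) := by gcongr
      _ = (D * B) * (A * (y - z) ^ 2) := by ring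
      _ ≤ (a * (B - A)) * (A * (y - z) ^ 2) := by gcongr
      _ = _ := by ring
  have h8 := le_of_mul_le_mul_right h7 (by linarith : 0 < B - A)
  linarith

theorem aux_alg {a b p y z : ℝ} (ha : 0 < a) (hb : 0 < b) (hp0 : 0 < p) (hp1 : p < 1) :
    (a - b) * (a ^ (p - 1) * y ^ 2 - b ^ (p - 1) * z ^ 2) ≤
      (1 - p)⁻¹ * a ^ p * (y - z) ^ 2 + (1 - p)⁻¹ * b ^ p * (y - z) ^ 2 := by
  have hq : 0 < 1 - p := by linarith
  have h1 : 0 ≤ (1 - p)⁻¹ * a ^ p * (y - z) ^ 2 := by positivity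
  have h2 : 0 ≤ (1 - p)⁻¹ * b ^ p * (y - z) ^ 2 := by positivity
  rcases le_total b a with h | h
  · have := aux_alg_le (y := y) (z := z) hb h hp0 hp1
    linarith
  · have := aux_alg_le (y := z) (z := y) ha h hp0 hp1
    have e : (z - y) ^ 2 = (y - z) ^ 2 := by ring
    rw [e] at this
    nlinarith

theorem aux_kernel_int (N : ℕ) (hN : 2 ≤ N) (s : ℝ) (hs : s ∈ Set.Ioo (0 : ℝ) 1) :
    Integrable (fun z : E N => min 1 (‖z‖ ^ 2) * ‖z‖ ^ (-((N : ℝ) + 2 * s))) := by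
  have : Nontrivial (E N) := by
    have : Nonempty (Fin N) := ⟨⟨0, by omega⟩⟩
    infer_instance
  have := (integrable_fun_norm_addHaar (E := E N) volume
    (f := fun y : ℝ => min 1 (y ^ 2) * y ^ (-((N : ℝ) + 2 * s)))).2 ?_
  · exact this
  have hfr : Module.finrank ℝ (E N) = N := by simp
  rw [hfr]
  have hs0 := hs.1
  have hs1 := hs.2
  have hN1 : ((N - 1 : ℕ) : ℝ) = (N : ℝ) - 1 := by
    rw [Nat.cast_sub (by omega)]; simp
  have hpw : ∀ y : ℝ, 0 < y → y ^ (N - 1) * y ^ (-((N : ℝ) + 2 * s)) = y ^ (-1 - 2 * s) := by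
    intro y hy
    rw [← Real.rpow_natCast, ← Real.rpow_add hy, hN1]; congr 1; ring
  have hu : Ioi (0 : ℝ) = Ioc 0 1 ∪ Ioi 1 := by rw [Ioc_union_Ioi_eq_Ioi]; norm_num
  rw [hu]
  apply IntegrableOn.union
  · have h1 : IntegrableOn (fun y : ℝ => y ^ (1 - 2 * s)) (Ioc 0 1) := by
      have := intervalIntegral.intervalIntegrable_rpow' (a := 0) (b := 1) (r := 1 - 2 * s)
        (by linarith)
      rwa [intervalIntegrable_iff_integrableOn_Ioc_of_le (by norm_num)] at this
    refine h1.congr_fun ?_ measurableSet_Ioc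
    intro y hy
    have hy0 : 0 < y := hy.1
    have : min 1 (y ^ 2) = y ^ 2 := min_eq_right (by nlinarith [hy.2])
    simp only [smul_eq_mul, this]
    rw [mul_left_comm, hpw y hy0, ← Real.rpow_natCast, ← Real.rpow_add hy0]
    congr 1; push_cast; ring
  · have h1 : IntegrableOn (fun y : ℝ => y ^ (-1 - 2 * s)) (Ioi 1) :=
      integrableOn_Ioi_rpow_of_lt (by linarith) (by norm_num)
    refine h1.congr_fun ?_ measurableSet_Ioi
    intro y hy
    have hy1 : 1 < y := hy
    have : min 1 (y ^ 2) = 1 := min_eq_left (by nlinarith)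
    simp only [smul_eq_mul, this, one_mul]
    rw [hpw y (by linarith)]

def CK (N : ℕ) (s : ℝ) : ℝ := ∫ z : E N, min 1 (‖z‖ ^ 2) * ‖z‖ ^ (-((N : ℝ) + 2 * s))

theorem CK_nonneg (N : ℕ) (s : ℝ) : 0 ≤ CK N s := by
  unfold CK
  apply integral_nonneg
  intro z
  simp only [Pi.zero_apply]
  positivity

theorem aux_psi_kernel (N : ℕ) (hN : 2 ≤ N) (s : ℝ) (hs : s ∈ Set.Ioo (0 : ℝ) 1) {L : ℝ}
    (hL : 1 ≤ L) {ψ : E N → ℝ} (hψ : Measurable ψ) (hψL : ∀ x y, |ψ x - ψ y| ≤ L * ‖x - y‖)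
    (hψ0 : ∀ x, 0 ≤ ψ x) (hψ1 : ∀ x, ψ x ≤ 1) (x : E N) :
    Integrable (fun y => (ψ x - ψ y) ^ 2 * ‖x - y‖ ^ (-((N : ℝ) + 2 * s))) ∧
    ∫ y, (ψ x - ψ y) ^ 2 * ‖x - y‖ ^ (-((N : ℝ) + 2 * s)) ≤ L ^ 2 * CK N s := by
  have h0 := aux_kernel_int N hN s hs
  have h1 := (h0.comp_sub_left x).const_mul (L ^ 2)
  have hle : ∀ y, (ψ x - ψ y) ^ 2 * ‖x - y‖ ^ (-((N : ℝ) + 2 * s)) ≤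
      L ^ 2 * (min 1 (‖x - y‖ ^ 2) * ‖x - y‖ ^ (-((N : ℝ) + 2 * s))) := by
    intro y
    rw [← mul_assoc]
    gcongr
    rw [mul_min_of_nonneg _ _ (by positivity)]
    apply le_min
    · have : |ψ x - ψ y| ≤ 1 := by
        rw [abs_le]; constructor <;> linarith [hψ0 x, hψ0 y, hψ1 x, hψ1 y]
      rw [← sq_abs]
      have : |ψ x - ψ y| ^ 2 ≤ 1 ^ 2 := by gcongr
      nlinarith
    · rw [← sq_abs, ← mul_pow]
      gcongr
      exact hψL x y
  have hint : Integrable (fun y => (ψ x - ψ y) ^ 2 * ‖x - y‖ ^ (-((N : ℝ) + 2 * s))) := by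
    refine h1.mono' ?_ ?_
    · apply Measurable.aestronglyMeasurable
      fun_prop
    · filter_upwards with y
      rw [Real.norm_of_nonneg (by positivity)]
      exact hle y
  refine ⟨hint, ?_⟩
  calc _ ≤ ∫ y, L ^ 2 * (min 1 (‖x - y‖ ^ 2) * ‖x - y‖ ^ (-((N : ℝ) + 2 * s))) :=
        integral_mono hint h1 hle
    _ = L ^ 2 * CK N s := by
        rw [integral_const_mul]
        congr 1
        exact integral_sub_left_eq_self
          (fun z : E N => min 1 (‖z‖ ^ 2) * ‖z‖ ^ (-((N : ℝ) + 2 * s))) volume x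

theorem aux_NL (N : ℕ) (hN : 2 ≤ N) (s : ℝ) (hs : s ∈ Set.Ioo (0 : ℝ) 1)
    {Λ p L M c l Mw : ℝ} (hΛ : 0 ≤ Λ) (hp0 : 0 < p) (hp1 : p < 1) (hL : 1 ≤ L) (hM : 0 ≤ M)
    (hc : 0 ≤ c) {k : E N → E N → ℝ} (hk0 : ∀ x y, x ≠ y → 0 ≤ k x y)
    (hkΛ : ∀ x y, x ≠ y → k x y ≤ Λ * ‖x - y‖ ^ (-((N : ℝ) + 2 * s)))
    {B : Set (E N)} (hB : MeasurableSet B) (hBfin : volume B < ⊤)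
    {w g ψ : E N → ℝ} (hw : Measurable w) (hg : Measurable g) (hψ : Measurable ψ)
    (hl : 0 < l) (hwl : ∀ x ∈ B, l ≤ w x) (hwM : ∀ x ∈ B, w x ≤ Mw)
    (hg0 : ∀ y, 0 ≤ g y) (hwg : ∀ y, -g y ≤ w y)
    (hψL : ∀ x y, |ψ x - ψ y| ≤ L * ‖x - y‖) (hψ0 : ∀ x, 0 ≤ ψ x) (hψ1 : ∀ x, ψ x ≤ 1)
    (hψB : ∀ x, x ∉ B → ψ x = 0)
    (hgB : ∀ x ∈ B, Integrable (fun y => g y * ‖x - y‖ ^ (-((N : ℝ) + 2 * s))))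
    (hgM : ∀ x ∈ B, ∫ y, g y * ‖x - y‖ ^ (-((N : ℝ) + 2 * s)) ≤ M * w x) :
    ∫ x, ∫ y, (w x - w y) * (c * (ψ x ^ 2 * w x ^ (p - 1)) - c * (ψ y ^ 2 * w y ^ (p - 1))) * k x y
      ≤ c * (2 * Λ * ((1 - p)⁻¹ * L ^ 2 * CK N s + M)) * ∫ x in B, w x ^ p := by
  have hq : 0 < 1 - p := by linarith
  have hwpos : ∀ x ∈ B, 0 < w x := fun x hx => lt_of_lt_of_le hl (hwl x hx)
  set h : E N → E N → ℝ := fun x y => B.indicator (fun x => Λ * ((1 - p)⁻¹ * w x ^ p *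
    ((ψ x - ψ y) ^ 2 * ‖x - y‖ ^ (-((N : ℝ) + 2 * s))) + w x ^ (p - 1) *
      (g y * ‖x - y‖ ^ (-((N : ℝ) + 2 * s))))) x with hh
  have hnn : ∀ x y, 0 ≤ h x y := by
    intro x y
    apply indicator_nonneg
    intro x hx
    have := hwpos x hx
    have := hg0 y
    positivity
  have hmeas : Measurable (fun z : E N × E N => h z.1 z.2) := by
    have : (fun z : E N × E N => h z.1 z.2) = (Prod.fst ⁻¹' B).indicator (fun z : E N × E N =>
      Λ * ((1 - p)⁻¹ * w z.1 ^ p *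
    ((ψ z.1 - ψ z.2) ^ 2 * ‖z.1 - z.2‖ ^ (-((N : ℝ) + 2 * s))) + w z.1 ^ (p - 1) *
      (g z.2 * ‖z.1 - z.2‖ ^ (-((N : ℝ) + 2 * s))))) := by
      ext z
      simp only [hh, indicator]
      rfl
    rw [this]
    apply Measurable.indicator _ (measurable_fst hB)
    fun_prop
  have hin : ∀ x, Integrable (fun y => h x y) := by
    intro x
    by_cases hx : x ∈ B
    · simp only [hh, indicator_of_mem hx]
      exact (((aux_psi_kernel N hN s hs hL hψ hψL hψ0 hψ1 x).1.const_mul _).add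
        ((hgB x hx).const_mul _)).const_mul _
    · simp only [hh, indicator_of_notMem hx]
      exact integrable_zero _ _ _
  set D := Λ * ((1 - p)⁻¹ * L ^ 2 * CK N s + M) with hD
  have hCK := CK_nonneg N s
  have hD0 : 0 ≤ D := by positivity
  have hile : ∀ x, ∫ y, h x y ≤ B.indicator (fun x => D * w x ^ p) x := by
    intro x
    by_cases hx : x ∈ B
    · simp only [hh, indicator_of_mem hx]
      have e1 := aux_psi_kernel N hN s hs hL hψ hψL hψ0 hψ1 x
      rw [integral_const_mul, integral_add (e1.1.const_mul _) ((hgB x hx).const_mul _),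
        integral_const_mul, integral_const_mul]
      have hwx := hwpos x hx
      have e2 : w x ^ p = w x ^ (p - 1) * w x := by
        rw [← Real.rpow_add_one hwx.ne']; congr 1; ring
      calc _ ≤ Λ * ((1 - p)⁻¹ * w x ^ p * (L ^ 2 * CK N s) + w x ^ (p - 1) * (M * w x)) := by
            gcongr
            · exact e1.2
            · exact hgM x hx
        _ = D * w x ^ p := by rw [hD, e2]; ring
    · simp only [hh, indicator_of_notMem hx]
      simp
  have hwB : IntegrableOn (fun x => w x ^ p) B := by
    refine Measure.integrableOn_of_bounded (M := Mw ^ p) hBfin.ne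
      (by apply Measurable.aestronglyMeasurable; fun_prop) ?_
    filter_upwards [ae_restrict_mem hB] with x hx
    have := hwpos x hx
    rw [Real.norm_of_nonneg (by positivity)]
    gcongr
    exact hwM x hx
  have hbig : Integrable (B.indicator (fun x => D * w x ^ p)) := by
    rw [integrable_indicator_iff hB]
    exact hwB.const_mul D
  have hprod : Integrable (fun z : E N × E N => h z.1 z.2) (volume.prod volume) := by
    rw [integrable_prod_iff hmeas.aestronglyMeasurable]
    refine ⟨Filter.Eventually.of_forall hin, ?_⟩
    refine hbig.mono' ?_ ?_
    · exact hmeas.aestronglyMeasurable.norm.integral_prod_right'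
    · filter_upwards with x
      have : ∀ y, ‖h x y‖ = h x y := fun y => Real.norm_of_nonneg (hnn x y)
      simp only [this]
      rw [Real.norm_of_nonneg (integral_nonneg (hnn x))]
      exact hile x
  have hprod' : Integrable (fun z : E N × E N => h z.2 z.1) (volume.prod volume) := hprod.swap
  have hsum : Integrable (fun z : E N × E N => c * (h z.1 z.2 + h z.2 z.1)) (volume.prod volume) :=
    (hprod.add hprod').const_mul c
  have hpt : ∀ x y, x ≠ y →
      (w x - w y) * (c * (ψ x ^ 2 * w x ^ (p - 1)) - c * (ψ y ^ 2 * w y ^ (p - 1))) * k x y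
      ≤ c * (h x y + h y x) := by
    intro x y hxy
    have hk := hk0 x y hxy
    have hk' := hkΛ x y hxy
    have hkap : 0 ≤ ‖x - y‖ ^ (-((N : ℝ) + 2 * s)) := by positivity
    have red : ∀ A : ℝ, 0 ≤ A →
        (w x - w y) * (ψ x ^ 2 * w x ^ (p - 1) - ψ y ^ 2 * w y ^ (p - 1)) ≤ A →
        A * (Λ * ‖x - y‖ ^ (-((N : ℝ) + 2 * s))) ≤ h x y + h y x →
        (w x - w y) * (c * (ψ x ^ 2 * w x ^ (p - 1)) - c * (ψ y ^ 2 * w y ^ (p - 1))) * k x y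
      ≤ c * (h x y + h y x) := by
      intro A hA h1 h2
      calc (w x - w y) * (c * (ψ x ^ 2 * w x ^ (p - 1)) - c * (ψ y ^ 2 * w y ^ (p - 1))) * k x y
          = c * (((w x - w y) * (ψ x ^ 2 * w x ^ (p - 1) - ψ y ^ 2 * w y ^ (p - 1))) * k x y) := by
            ring
        _ ≤ c * (A * k x y) := by gcongr
        _ ≤ c * (A * (Λ * ‖x - y‖ ^ (-((N : ℝ) + 2 * s)))) := by gcongr
        _ ≤ _ := by gcongr
    have one : ∀ x y : E N, x ∈ B → y ∉ B →
        (w x - w y) * (ψ x ^ 2 * w x ^ (p - 1)) ≤ (1 - p)⁻¹ * w x ^ p * (ψ x - ψ y) ^ 2 +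
          w x ^ (p - 1) * g y := by
      intro x y hx hy
      have hwx := hwpos x hx
      have e2 : w x ^ p = w x ^ (p - 1) * w x := by
        rw [← Real.rpow_add_one hwx.ne']; congr 1; ring
      have hA : 0 < w x ^ (p - 1) := by positivity
      rw [hψB y hy, sub_zero]
      have hp' : 1 ≤ (1 - p)⁻¹ := by
        rw [one_le_inv₀ hq]; linarith
      have hψ2 : ψ x ^ 2 ≤ 1 := by nlinarith [hψ0 x, hψ1 x]
      calc (w x - w y) * (ψ x ^ 2 * w x ^ (p - 1)) ≤ (w x + g y) * (ψ x ^ 2 * w x ^ (p - 1)) := by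
            gcongr
            linarith [hwg y]
        _ = 1 * (w x ^ (p - 1) * w x) * ψ x ^ 2 + ψ x ^ 2 * (w x ^ (p - 1) * g y) := by ring
        _ ≤ (1 - p)⁻¹ * (w x ^ (p - 1) * w x) * ψ x ^ 2 + 1 * (w x ^ (p - 1) * g y) := by
            have := hg0 y
            gcongr
        _ = _ := by rw [e2]; ring
    by_cases hx : x ∈ B <;> by_cases hy : y ∈ B
    · have hwx := hwpos x hx
      have hwy := hwpos y hy
      refine red ((1 - p)⁻¹ * w x ^ p * (ψ x - ψ y) ^ 2 + (1 - p)⁻¹ * w y ^ p * (ψ x - ψ y) ^ 2)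
        (by positivity) ?_ ?_
      · have := aux_alg (y := ψ x) (z := ψ y) hwx hwy hp0 hp1
        rw [mul_comm (ψ x ^ 2), mul_comm (ψ y ^ 2)]
        exact this
      · simp only [hh, indicator_of_mem hx, indicator_of_mem hy]
        rw [norm_sub_rev y x]
        have h1 : 0 ≤ Λ * (w x ^ (p - 1) * (g y * ‖x - y‖ ^ (-((N : ℝ) + 2 * s)))) := by
          have := hg0 y
          positivity
        have h2 : 0 ≤ Λ * (w y ^ (p - 1) * (g x * ‖x - y‖ ^ (-((N : ℝ) + 2 * s)))) := by
          have := hg0 x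
          positivity
        have e : (ψ y - ψ x) ^ 2 = (ψ x - ψ y) ^ 2 := by ring
        rw [e]
        linarith
    · have hwx := hwpos x hx
      have hgy := hg0 y
      refine red _ ?_ ?_ (?_ : ((1 - p)⁻¹ * w x ^ p * (ψ x - ψ y) ^ 2 +
          w x ^ (p - 1) * g y) * (Λ * ‖x - y‖ ^ (-((N : ℝ) + 2 * s))) ≤ _)
      · positivity
      · have := one x y hx hy
        rw [hψB y hy] at this ⊢
        simpa using this
      · simp only [hh, indicator_of_mem hx, indicator_of_notMem hy]
        apply le_of_eq; ring
    · have hwy := hwpos y hy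
      have hgx := hg0 x
      refine red _ ?_ ?_ (?_ : ((1 - p)⁻¹ * w y ^ p * (ψ y - ψ x) ^ 2 +
          w y ^ (p - 1) * g x) * (Λ * ‖x - y‖ ^ (-((N : ℝ) + 2 * s))) ≤ _)
      · positivity
      · have := one y x hy hx
        rw [hψB x hx] at this ⊢
        refine le_trans (le_of_eq ?_) this
        ring
      · simp only [hh, indicator_of_mem hy, indicator_of_notMem hx]
        rw [norm_sub_rev y x]
        apply le_of_eq; ring
    · rw [hψB x hx, hψB y hy]
      have h1 := hnn x y
      have h2 := hnn y x
      have : 0 ≤ c * (h x y + h y x) := by positivity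
      simpa using this
  have hne : ∀ x : E N, ∀ᵐ y : E N, x ≠ y := by
    intro x
    have : Nontrivial (E N) := by
      have : Nonempty (Fin N) := ⟨⟨0, by omega⟩⟩
      infer_instance
    have h0 : volume ({x} : Set (E N)) = 0 := measure_singleton x
    rw [ae_iff]
    convert h0 using 2
    ext y; simp [eq_comm]
  have step1 : ∀ᵐ x : E N, (∫ y, (w x - w y) * (c * (ψ x ^ 2 * w x ^ (p - 1)) -
      c * (ψ y ^ 2 * w y ^ (p - 1))) * k x y) ≤ ∫ y, c * (h x y + h y x) := by
    filter_upwards [hsum.prod_right_ae] with x hx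
    refine aux_integral_le ?_ ?_ hx
    · filter_upwards [hne x] with y hy
      exact hpt x y hy
    · filter_upwards with y
      have h1 := hnn x y
      have h2 := hnn y x
      simp only [Pi.zero_apply]
      positivity
  calc _ ≤ ∫ x, ∫ y, c * (h x y + h y x) := by
        refine aux_integral_le step1 ?_ hsum.integral_prod_left
        filter_upwards with x
        apply integral_nonneg
        intro y
        have h1 := hnn x y
        have h2 := hnn y x
        simp only [Pi.zero_apply]
        positivity
    _ = ∫ z : E N × E N, c * (h z.1 z.2 + h z.2 z.1) ∂(volume.prod volume) :=
        (integral_prod _ hsum).symm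
    _ = c * (2 * ∫ x, ∫ y, h x y) := by
        rw [integral_const_mul, integral_add hprod hprod']
        have : ∫ z : E N × E N, h z.2 z.1 ∂(volume.prod volume) =
            ∫ z : E N × E N, h z.1 z.2 ∂(volume.prod volume) :=
          integral_prod_swap (μ := volume) (ν := volume) (fun z : E N × E N => h z.1 z.2)
        rw [this, integral_prod _ hprod]; ring
    _ ≤ c * (2 * ∫ x, B.indicator (fun x => D * w x ^ p) x) := by
        gcongr
        · exact hprod.integral_prod_left
        · exact hile
    _ = _ := by
        rw [integral_indicator hB, integral_const_mul, hD]; ring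

theorem aux_quad {p X Y Z : ℝ} (hp0 : 0 < p) (hp1 : p < 1) (hX : 0 ≤ X) (hY : 0 ≤ Y)
    (hZ : |Z| ≤ X * Y) :
    -(p * (1 - p)) * X ^ 2 + 2 * p * Z ≤
      -(1 - p) * ((p / 2) ^ 2 * X ^ 2 + p * Z + Y ^ 2) + 4 / (1 - p) * Y ^ 2 := by
  have hq : 0 < 1 - p := by linarith
  have hZ' := (abs_le.1 hZ).2
  have h1 : p * (3 - p) * Z ≤ p * (3 - p) * (X * Y) := by
    apply mul_le_mul_of_nonneg_left hZ' (by nlinarith)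
  have h2 : 0 ≤ p * (1 - p) * (1 - p / 4) * X ^ 2 - p * (3 - p) * (X * Y) +
      (4 / (1 - p) - (1 - p)) * Y ^ 2 := by
    have h3 : 4 / (1 - p) - (1 - p) ≥ 3 * p / (1 - p) := by
      rw [ge_iff_le, div_le_iff₀ hq, sub_mul, div_mul_cancel₀ _ hq.ne']
      nlinarith
    have h4 : 3 * p / (1 - p) * Y ^ 2 ≤ (4 / (1 - p) - (1 - p)) * Y ^ 2 := by gcongr
    have h5 : 0 ≤ p * (1 - p) * (1 - p / 4) * X ^ 2 - p * (3 - p) * (X * Y) +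
        3 * p / (1 - p) * Y ^ 2 := by
      have e : p * (1 - p) * (1 - p / 4) * X ^ 2 - p * (3 - p) * (X * Y) +
        3 * p / (1 - p) * Y ^ 2 = p / (1 - p) * ((1 - p / 4) * ((1 - p) * X) ^ 2 -
          (3 - p) * (((1 - p) * X) * Y) + 3 * Y ^ 2) := by
        field_simp
      rw [e]
      apply mul_nonneg (by positivity)
      have hU : 0 ≤ (1 - p) * X := by positivity
      generalize (1 - p) * X = U at *
      nlinarith [sq_nonneg (U - 2 * Y), mul_nonneg hU hY, sq_nonneg (U / 2 - Y), mul_nonneg hp0.le (mul_nonneg hU hY), mul_nonneg hq.le (sq_nonneg U)]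
    linarith
  nlinarith

theorem aux_grad_pt {N : ℕ} {p c : ℝ} (hp0 : 0 < p) (hp1 : p < 1) (hc : 0 ≤ c)
    {f ψ : E N → ℝ} {x : E N} (hf : DifferentiableAt ℝ f x) (hψ : DifferentiableAt ℝ ψ x)
    (hfx : 0 < f x) :
    p * ⟪gradient f x, gradient (fun y => c * (ψ y ^ 2 * f y ^ (p - 1))) x⟫ ≤
      c * (-(1 - p) * ‖fderiv ℝ (fun y => ψ y * f y ^ (p / 2)) x‖ ^ 2 +
        4 / (1 - p) * (f x ^ p * ‖fderiv ℝ ψ x‖ ^ 2)) := by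
  have hf1 := hf.hasFDerivAt
  have hψ1 := hψ.hasFDerivAt
  have d1 : fderiv ℝ (fun y => c * (ψ y ^ 2 * f y ^ (p - 1))) x =
      (c * ((p - 1) * ψ x ^ 2 * f x ^ (p - 2))) • fderiv ℝ f x +
        (c * (2 * ψ x * f x ^ (p - 1))) • fderiv ℝ ψ x := by
    have h1 := ((hψ1.pow 2).mul (hf1.rpow_const (p := p - 1) (Or.inl hfx.ne'))).const_mul c
    have := h1.fderiv
    simp only [Pi.mul_apply, Pi.pow_apply] at this
    refine Eq.trans ?_ (this.trans ?_)
    · rfl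
    · rw [show p - 1 - 1 = p - 2 by ring]
      ext v
      simp
      ring
  have d2 : fderiv ℝ (fun y => ψ y * f y ^ (p / 2)) x =
      ((p / 2) * ψ x * f x ^ (p / 2 - 1)) • fderiv ℝ f x + (f x ^ (p / 2)) • fderiv ℝ ψ x := by
    have h1 := (hψ1.mul (hf1.rpow_const (p := p / 2) (Or.inl hfx.ne')))
    refine Eq.trans ?_ (h1.fderiv.trans ?_)
    · rfl
    · ext v
      simp
      ring
  have hn : ∀ g : E N → ℝ, ‖fderiv ℝ g x‖ = ‖gradient g x‖ := by
    intro g; unfold gradient; simp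
  have g1 : gradient (fun y => c * (ψ y ^ 2 * f y ^ (p - 1))) x =
      (c * ((p - 1) * ψ x ^ 2 * f x ^ (p - 2))) • gradient f x +
        (c * (2 * ψ x * f x ^ (p - 1))) • gradient ψ x := by
    unfold gradient; rw [d1]; simp
  have g2 : gradient (fun y => ψ y * f y ^ (p / 2)) x =
      ((p / 2) * ψ x * f x ^ (p / 2 - 1)) • gradient f x + (f x ^ (p / 2)) • gradient ψ x := by
    unfold gradient; rw [d2]; simp
  rw [hn, hn, g1, g2]
  set a := gradient f x
  set b := gradient ψ x
  set P := f x ^ (p / 2) with hP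
  have hPpos : 0 < P := by positivity
  have e1 : f x ^ (p / 2 - 1) = P / f x := by rw [Real.rpow_sub_one hfx.ne']
  have e0 : f x ^ p = P ^ 2 := by
    rw [hP, ← Real.rpow_natCast, ← Real.rpow_mul hfx.le]; congr 1; push_cast; ring
  have e2 : f x ^ (p - 1) = P ^ 2 / f x := by rw [Real.rpow_sub_one hfx.ne', e0]
  have e3 : f x ^ (p - 2) = P ^ 2 / f x ^ 2 := by
    rw [show p - 2 = p - 1 - 1 by ring, Real.rpow_sub_one hfx.ne', e2]; field_simp
  rw [e0, e1, e2, e3]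
  have hnorm : ‖(p / 2 * ψ x * (P / f x)) • a + P • b‖ ^ 2 =
      (p / 2) ^ 2 * (|ψ x| * (P / f x) * ‖a‖) ^ 2 + p * (ψ x * (P / f x) * P * ⟪a, b⟫) +
        (P * ‖b‖) ^ 2 := by
    rw [norm_add_sq_real, norm_smul, norm_smul, inner_smul_left, inner_smul_right]
    simp only [Real.norm_eq_abs, mul_pow, sq_abs, conj_trivial]
    ring
  have hq := aux_quad (X := |ψ x| * (P / f x) * ‖a‖) (Y := P * ‖b‖)
    (Z := ψ x * (P / f x) * P * ⟪a, b⟫) hp0 hp1 (by positivity) (by positivity) (by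
      rw [abs_mul, abs_mul, abs_mul, abs_of_pos (by positivity : 0 < P / f x), abs_of_pos hPpos]
      calc _ ≤ |ψ x| * (P / f x) * P * (‖a‖ * ‖b‖) := by
            gcongr; exact abs_real_inner_le_norm a b
        _ = _ := by ring)
  rw [hnorm]
  rw [inner_add_right, inner_smul_right, inner_smul_right, real_inner_self_eq_norm_sq]
  have hc2 := mul_le_mul_of_nonneg_left hq hc
  refine le_trans (le_of_eq ?_) (hc2.trans (le_of_eq ?_))
  · simp only [mul_pow, sq_abs]
    field_simp
    ring
  · ring

theorem aux_int_prod {N : ℕ} {f : E N → ℝ → ℝ} {ψ : E N → ℝ} {η : ℝ → ℝ}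
    (hf : Continuous (fun z : E N × ℝ => f z.1 z.2))
    (hψ : HasCompactSupport ψ) (hη : HasCompactSupport η)
    (h1 : ∀ x t, x ∉ tsupport ψ → f x t = 0) (h2 : ∀ x t, t ∉ tsupport η → f x t = 0) :
    Integrable (fun z : E N × ℝ => f z.1 z.2) (volume.prod volume) := by
  have : HasCompactSupport (fun z : E N × ℝ => f z.1 z.2) := by
    refine HasCompactSupport.intro (hψ.isCompact.prod hη.isCompact) ?_
    intro z hz
    by_cases h : z.1 ∈ tsupport ψ
    · exact h2 _ _ (fun h' => hz ⟨h, h'⟩)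
    · exact h1 _ _ h
  exact hf.integrable_of_hasCompactSupport this

section
variable {N : ℕ} {W : E N → ℝ → ℝ}

theorem aux_Wt (hW : ContDiff ℝ (⊤ : ℕ∞) (fun z : E N × ℝ => W z.1 z.2)) :
    Continuous (fun z : E N × ℝ => deriv (fun τ => W z.1 τ) z.2) := by
  have h : ContDiff ℝ 1 (Function.uncurry (fun (z : E N × ℝ) (τ : ℝ) => W z.1 τ)) := by
    have : ContDiff ℝ 1 (fun z : E N × ℝ => W z.1 z.2) := hW.of_le (by exact_mod_cast le_top)
    exact this.comp (f := fun y : (E N × ℝ) × ℝ => (y.1.1, y.2)) (by fun_prop)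
  have := (ContDiff.fderiv (n := 0) h (g := fun z : E N × ℝ => z.2) (by fun_prop)
    (by norm_num)).continuous
  have h2 := this.clm_apply (continuous_const (y := (1 : ℝ)))
  exact h2

theorem aux_Dx {v : E N → ℝ → ℝ} (hv : ContDiff ℝ (⊤ : ℕ∞) (fun z : E N × ℝ => v z.1 z.2)) :
    Continuous (fun z : E N × ℝ => fderiv ℝ (fun y => v y z.2) z.1) := by
  have h : ContDiff ℝ 1 (Function.uncurry (fun (z : E N × ℝ) (y : E N) => v y z.2)) := by
    have : ContDiff ℝ 1 (fun z : E N × ℝ => v z.1 z.2) := hv.of_le (by exact_mod_cast le_top)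
    exact this.comp (f := fun y : (E N × ℝ) × E N => (y.2, y.1.2)) (by fun_prop)
  exact (ContDiff.fderiv (n := 0) h (g := fun z : E N × ℝ => z.1) (by fun_prop)
    (by norm_num)).continuous

theorem aux_sliceT (hW : ContDiff ℝ (⊤ : ℕ∞) (fun z : E N × ℝ => W z.1 z.2)) (x : E N) :
    Differentiable ℝ (fun τ => W x τ) := by
  have : ContDiff ℝ (⊤ : ℕ∞) (fun τ => W x τ) :=
    hW.comp (f := fun τ : ℝ => (x, τ)) (by fun_prop)
  exact this.differentiable (by simp)

theorem aux_sliceX (hW : ContDiff ℝ (⊤ : ℕ∞) (fun z : E N × ℝ => W z.1 z.2)) (t : ℝ) :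
    ContDiff ℝ (⊤ : ℕ∞) (fun y => W y t) :=
  hW.comp (f := fun y : E N => (y, t)) (by fun_prop)

theorem aux_rpow_smooth (hW : ContDiff ℝ (⊤ : ℕ∞) (fun z : E N × ℝ => W z.1 z.2))
    (hpos : ∀ x t, 0 < W x t) (a : ℝ) :
    ContDiff ℝ (⊤ : ℕ∞) (fun z : E N × ℝ => W z.1 z.2 ^ a) :=
  hW.rpow_const_of_ne (fun z => (hpos z.1 z.2).ne')

theorem aux_v_smooth (hW : ContDiff ℝ (⊤ : ℕ∞) (fun z : E N × ℝ => W z.1 z.2))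
    (hpos : ∀ x t, 0 < W x t) {ψ : E N → ℝ} (hψ : ContDiff ℝ (⊤ : ℕ∞) ψ) (a : ℝ) :
    ContDiff ℝ (⊤ : ℕ∞) (fun z : E N × ℝ => ψ z.1 * W z.1 z.2 ^ a) :=
  (hψ.comp contDiff_fst).mul (aux_rpow_smooth hW hpos a)

theorem aux_time {p : ℝ} (hp0 : 0 < p)
    (hW : ContDiff ℝ (⊤ : ℕ∞) (fun z : E N × ℝ => W z.1 z.2)) (hpos : ∀ x t, 0 < W x t)
    {ψ : E N → ℝ} {η : ℝ → ℝ} (hψ : ContDiff ℝ (⊤ : ℕ∞) ψ) (hη : ContDiff ℝ (⊤ : ℕ∞) η)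
    (hψc : HasCompactSupport ψ) (hηc : HasCompactSupport η) :
    ∫ t, ∫ x, W x t * deriv (fun τ => η τ * (ψ x ^ 2 * W x τ ^ (p - 1))) t =
      p⁻¹ * ∫ t, deriv η t * ∫ x, ψ x ^ 2 * W x t ^ p := by
  have hWt := aux_Wt hW
  have hWp := (aux_rpow_smooth hW hpos p).continuous
  have hWp1 := (aux_rpow_smooth hW hpos (p - 1)).continuous
  have hη' : Continuous (deriv η) := (hη.continuous_deriv (by simp))
  have hψ' := hψ.continuous
  have hη0 := hη.continuous
  have hηd : Differentiable ℝ η := hη.differentiable (by simp)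
  have hdη : ∀ t, t ∉ tsupport η → deriv η t = 0 := fun t ht =>
    image_eq_zero_of_notMem_tsupport (fun h => ht (tsupport_deriv_subset (𝕜 := ℝ) h))
  have hη00 : ∀ t, t ∉ tsupport η → η t = 0 := fun t ht => image_eq_zero_of_notMem_tsupport ht
  have hψ00 : ∀ x, x ∉ tsupport ψ → ψ x = 0 := fun t ht => image_eq_zero_of_notMem_tsupport ht
  set J1 : E N → ℝ → ℝ := fun x t => deriv η t * (ψ x ^ 2 * W x t ^ p) with hJ1
  set J4 : E N → ℝ → ℝ := fun x t => ψ x ^ 2 * (deriv η t * W x t ^ p +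
    η t * (deriv (fun τ => W x τ) t * p * W x t ^ (p - 1))) with hJ4
  have I1 : Integrable (fun z : E N × ℝ => J1 z.1 z.2) (volume.prod volume) := by
    refine aux_int_prod ?_ hψc hηc ?_ ?_
    · simp only [hJ1]; fun_prop
    · intro x t hx; simp [hJ1, hψ00 x hx]
    · intro x t ht; simp [hJ1, hdη t ht]
  have I4 : Integrable (fun z : E N × ℝ => J4 z.1 z.2) (volume.prod volume) := by
    refine aux_int_prod ?_ hψc hηc ?_ ?_
    · simp only [hJ4]; fun_prop
    · intro x t hx; simp [hJ4, hψ00 x hx]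
    · intro x t ht; simp [hJ4, hdη t ht, hη00 t ht]
  have hd : ∀ a x t, HasDerivAt (fun τ => W x τ ^ a)
      (deriv (fun τ => W x τ) t * a * W x t ^ (a - 1)) t := by
    intro a x t
    exact (aux_sliceT hW x t).hasDerivAt.rpow_const (Or.inl (hpos x t).ne')
  have hpt : ∀ x t, W x t * deriv (fun τ => η τ * (ψ x ^ 2 * W x τ ^ (p - 1))) t =
      p⁻¹ * J1 x t + ((p - 1) / p) * J4 x t := by
    intro x t
    have h1 := ((hηd t).hasDerivAt.mul ((hd (p - 1) x t).const_mul (ψ x ^ 2)))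
    have h1' : deriv (fun τ => η τ * (ψ x ^ 2 * W x τ ^ (p - 1))) t = _ := h1.deriv
    rw [h1']
    simp only [hJ1, hJ4]
    have e : W x t ^ (p - 1) = W x t ^ p / W x t := Real.rpow_sub_one (hpos x t).ne' _
    have e2 : W x t ^ (p - 1 - 1) = W x t ^ p / W x t / W x t := by
      rw [Real.rpow_sub_one (hpos x t).ne', e]
    have := hpos x t
    rw [e2, e]
    field_simp
    ring
  have Z : ∫ t, ∫ x, J4 x t = 0 := by
    have e := integral_prod_symm _ I4
    rw [integral_prod _ I4] at e
    rw [← e]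
    have : ∀ x, ∫ t, J4 x t = 0 := by
      intro x
      simp only [hJ4]
      rw [integral_const_mul]
      have hη'c : HasCompactSupport (deriv η) := hηc.deriv
      have hWx : Continuous (fun t => W x t ^ p) :=
        hWp.comp (f := fun t : ℝ => (x, t)) (by fun_prop)
      have hWx1 : Continuous (fun t => W x t ^ (p - 1)) :=
        hWp1.comp (f := fun t : ℝ => (x, t)) (by fun_prop)
      have hWtx : Continuous (fun t => deriv (fun τ => W x τ) t) :=
        hWt.comp (f := fun t : ℝ => (x, t)) (by fun_prop)
      rw [integral_eq_zero_of_hasDerivAt_of_integrable (f := fun τ => η τ * W x τ ^ p), mul_zero]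
      · intro t
        exact (hηd t).hasDerivAt.mul (hd p x t)
      · apply Continuous.integrable_of_hasCompactSupport
        · fun_prop
        · refine HasCompactSupport.intro hηc.isCompact ?_
          intro t ht
          simp [hdη t ht, hη00 t ht]
      · apply Continuous.integrable_of_hasCompactSupport
        · fun_prop
        · refine HasCompactSupport.intro hηc.isCompact ?_
          intro t ht
          simp [hη00 t ht]
    simp only [this, integral_zero]
  simp_rw [hpt]
  have e1 : ∀ᵐ t : ℝ, ∫ x, (p⁻¹ * J1 x t + (p - 1) / p * J4 x t) =
      p⁻¹ * (∫ x, J1 x t) + (p - 1) / p * (∫ x, J4 x t) := by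
    filter_upwards [I1.prod_left_ae, I4.prod_left_ae] with t h1 h4
    rw [integral_add (h1.const_mul _) (h4.const_mul _)]
    congr 1 <;> exact integral_const_mul _ _
  rw [integral_congr_ae e1, integral_add (I1.integral_prod_right.const_mul _)
    (I4.integral_prod_right.const_mul _), integral_const_mul, integral_const_mul, Z, mul_zero,
    add_zero]
  simp only [hJ1, integral_const_mul]

theorem aux_space {p : ℝ} (hp0 : 0 < p) (hp1 : p < 1)
    (hW : ContDiff ℝ (⊤ : ℕ∞) (fun z : E N × ℝ => W z.1 z.2)) (hpos : ∀ x t, 0 < W x t)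
    {ψ : E N → ℝ} {η : ℝ → ℝ} (hψ : ContDiff ℝ (⊤ : ℕ∞) ψ) (hη : Continuous η)
    (hη0 : ∀ t, 0 ≤ η t)
    (hψc : HasCompactSupport ψ) (hηc : HasCompactSupport η) :
    p * ∫ t, ∫ x, ⟪gradient (fun y => W y t) x,
        gradient (fun y => η t * (ψ y ^ 2 * W y t ^ (p - 1))) x⟫ ≤
      -(1 - p) * (∫ t, η t * ∫ x, ‖fderiv ℝ (fun y => ψ y * W y t ^ (p / 2)) x‖ ^ 2) +
      4 / (1 - p) * (∫ t, η t * ∫ x, W x t ^ p * ‖fderiv ℝ ψ x‖ ^ 2) ∧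
    Continuous (fun z : E N × ℝ => ‖fderiv ℝ (fun y => ψ y * W y z.2 ^ (p / 2)) z.1‖ ^ 2) ∧
    (∀ x t, x ∉ tsupport ψ → ‖fderiv ℝ (fun y => ψ y * W y t ^ (p / 2)) x‖ ^ 2 = 0) := by
  have hWp := (aux_rpow_smooth hW hpos p).continuous
  have hv := aux_Dx (v := fun x t => ψ x * W x t ^ (p / 2)) (aux_v_smooth hW hpos hψ (p / 2))
  have hφ : ContDiff ℝ (⊤ : ℕ∞) (fun z : E N × ℝ => ψ z.1 ^ 2 * W z.1 z.2 ^ (p - 1)) :=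
    ((hψ.comp contDiff_fst).pow 2).mul (aux_rpow_smooth hW hpos (p - 1))
  have hDφ := aux_Dx (v := fun x t => ψ x ^ 2 * W x t ^ (p - 1)) hφ
  have hDW := aux_Dx hW
  have hDψ : Continuous (fun x => fderiv ℝ ψ x) := hψ.continuous_fderiv (by simp)
  have hη00 : ∀ t, t ∉ tsupport η → η t = 0 := fun t ht => image_eq_zero_of_notMem_tsupport ht
  have hev : ∀ x, x ∉ tsupport ψ → ψ =ᶠ[nhds x] 0 := fun x hx =>
    notMem_tsupport_iff_eventuallyEq.1 hx
  have hD0 : ∀ x, x ∉ tsupport ψ → fderiv ℝ ψ x = 0 := by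
    intro x hx
    rw [(hev x hx).fderiv_eq]; simp
  have hDv0 : ∀ x t, x ∉ tsupport ψ → fderiv ℝ (fun y => ψ y * W y t ^ (p / 2)) x = 0 := by
    intro x t hx
    have : (fun y => ψ y * W y t ^ (p / 2)) =ᶠ[nhds x] 0 := by
      filter_upwards [hev x hx] with y hy
      simp [hy]
    rw [this.fderiv_eq]; simp
  have hDφ0 : ∀ x t, x ∉ tsupport ψ → fderiv ℝ (fun y => ψ y ^ 2 * W y t ^ (p - 1)) x = 0 := by
    intro x t hx
    have : (fun y => ψ y ^ 2 * W y t ^ (p - 1)) =ᶠ[nhds x] 0 := by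
      filter_upwards [hev x hx] with y hy
      simp [hy]
    rw [this.fderiv_eq]; simp
  refine ⟨?_, by fun_prop, fun x t hx => by rw [hDv0 x t hx]; simp⟩
  set J2 : E N → ℝ → ℝ := fun x t => η t * ‖fderiv ℝ (fun y => ψ y * W y t ^ (p / 2)) x‖ ^ 2
    with hJ2
  set J3 : E N → ℝ → ℝ := fun x t => η t * (W x t ^ p * ‖fderiv ℝ ψ x‖ ^ 2) with hJ3
  set J0 : E N → ℝ → ℝ := fun x t => η t * (p * ⟪gradient (fun y => W y t) x,
        gradient (fun y => ψ y ^ 2 * W y t ^ (p - 1)) x⟫) with hJ0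
  have I2 : Integrable (fun z : E N × ℝ => J2 z.1 z.2) (volume.prod volume) := by
    refine aux_int_prod ?_ hψc hηc ?_ ?_
    · simp only [hJ2]; fun_prop
    · intro x t hx; simp [hJ2, hDv0 x t hx]
    · intro x t ht; simp [hJ2, hη00 t ht]
  have I3 : Integrable (fun z : E N × ℝ => J3 z.1 z.2) (volume.prod volume) := by
    refine aux_int_prod ?_ hψc hηc ?_ ?_
    · simp only [hJ3]; fun_prop
    · intro x t hx; simp [hJ3, hD0 x hx]
    · intro x t ht; simp [hJ3, hη00 t ht]
  have I0 : Integrable (fun z : E N × ℝ => J0 z.1 z.2) (volume.prod volume) := by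
    refine aux_int_prod ?_ hψc hηc ?_ ?_
    · simp only [hJ0, gradient]
      fun_prop
    · intro x t hx; simp [hJ0, gradient, hDφ0 x t hx]
    · intro x t ht; simp [hJ0, hη00 t ht]
  have hgr : ∀ x t, gradient (fun y => η t * (ψ y ^ 2 * W y t ^ (p - 1))) x =
      η t • gradient (fun y => ψ y ^ 2 * W y t ^ (p - 1)) x := by
    intro x t
    unfold gradient
    have hdd : DifferentiableAt ℝ (fun y => ψ y ^ 2 * W y t ^ (p - 1)) x :=
      ((aux_sliceX (W := fun x t => ψ x ^ 2 * W x t ^ (p - 1)) hφ t).differentiable (by simp)) x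
    rw [fderiv_const_mul hdd]
    simp
  have hJeq : ∀ x t, p * ⟪gradient (fun y => W y t) x,
        gradient (fun y => η t * (ψ y ^ 2 * W y t ^ (p - 1))) x⟫ = J0 x t := by
    intro x t
    rw [hgr, inner_smul_right]; simp only [hJ0]; ring
  have hpt : ∀ x t, J0 x t ≤ -(1 - p) * J2 x t + 4 / (1 - p) * J3 x t := by
    intro x t
    rw [← hJeq]
    refine (aux_grad_pt hp0 hp1 (hη0 t) (((aux_sliceX hW t).differentiable (by simp)) x)
      ((hψ.differentiable (by simp)) x) (hpos x t)).trans (le_of_eq ?_)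
    simp only [hJ2, hJ3]; ring
  have e0 : p * ∫ t, ∫ x, ⟪gradient (fun y => W y t) x,
        gradient (fun y => η t * (ψ y ^ 2 * W y t ^ (p - 1))) x⟫ = ∫ t, ∫ x, J0 x t := by
    rw [← integral_const_mul]
    congr 1; ext t
    rw [← integral_const_mul]
    congr 1; ext x
    exact hJeq x t
  have e2 : ∫ t, η t * ∫ x, ‖fderiv ℝ (fun y => ψ y * W y t ^ (p / 2)) x‖ ^ 2 =
      ∫ t, ∫ x, J2 x t := by
    simp only [hJ2, integral_const_mul]
  have e3 : ∫ t, η t * ∫ x, W x t ^ p * ‖fderiv ℝ ψ x‖ ^ 2 = ∫ t, ∫ x, J3 x t := by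
    simp only [hJ3, integral_const_mul]
  rw [e0, e2, e3, ← integral_prod_symm _ I0, ← integral_prod_symm _ I2, ← integral_prod_symm _ I3,
    ← integral_const_mul, ← integral_const_mul, ← integral_add (I2.const_mul _) (I3.const_mul _)]
  exact integral_mono I0 ((I2.const_mul _).add (I3.const_mul _)) (fun z => hpt z.1 z.2)
end

theorem kappa_facts (N : ℕ) (hN : 2 ≤ N) : 2 < kappa N ∧ 1 / 2 ≤ (kappa N)⁻¹ + (N : ℝ)⁻¹ ∧
    (kappa N)⁻¹ + (N : ℝ)⁻¹ ≤ 1 := by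
  unfold kappa
  split_ifs with h
  · have h3 : (2 : ℝ) < N := by exact_mod_cast h
    have h4 : 0 < (N : ℝ) - 2 := by linarith
    have e : (2 * (N : ℝ) / (N - 2))⁻¹ + (N : ℝ)⁻¹ = 1 / 2 := by
      field_simp
      ring
    rw [e]
    refine ⟨?_, le_rfl, by norm_num⟩
    rw [lt_div_iff₀ h4]; linarith
  · have : N = 2 := by omega
    subst this
    norm_num

theorem aux_lpcomp {N : ℕ} {F : Type*} [NormedAddCommGroup F] (f : E N → F) (hf : Continuous f)
    {S : Set (E N)} (hS : ∀ x, x ∉ S → f x = 0) {p q : ℝ≥0∞} (hpq : p ≤ q) :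
    eLpNorm f p volume ≤ eLpNorm f q volume * volume S ^ (1 / p.toReal - 1 / q.toReal) := by
  have hss : Function.support f ⊆ S := by
    intro x hx
    by_contra h
    exact hx (hS x h)
  rw [← eLpNorm_restrict_eq_of_support_subset hss,
      ← eLpNorm_restrict_eq_of_support_subset (p := q) hss]
  have := eLpNorm_le_eLpNorm_mul_rpow_measure_univ (μ := volume.restrict S)
      (f := f) hpq hf.aestronglyMeasurable
  simpa using this

theorem aux_sobolev (N : ℕ) (hN : 2 ≤ N) : ∃ CS : ℝ, 0 < CS ∧ ∀ (a : ℝ), 0 < a → ∀ (x₀ : E N)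
    (v : E N → ℝ), ContDiff ℝ 1 v → (∀ x, x ∉ ball x₀ a → v x = 0) →
    (∫ x, ‖v x‖ ^ kappa N) ^ (2 / kappa N) ≤
      CS * a ^ (2 * N / kappa N - N + 2) * ∫ x, ‖fderiv ℝ v x‖ ^ 2 := by
  obtain ⟨hk2, hk3, hk4⟩ := kappa_facts N hN
  set κ := kappa N with hκ
  have hN0 : (0 : ℝ) < N := by exact_mod_cast (by omega : 0 < N)
  have hκ0 : 0 < κ := by linarith
  set b := κ⁻¹ + (N : ℝ)⁻¹ with hb
  have hb0 : 0 < b := by positivity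
  set p0 : NNReal := ⟨b⁻¹, by positivity⟩ with hp0
  set k : NNReal := ⟨κ, hκ0.le⟩ with hk
  have hp0c : (p0 : ℝ) = b⁻¹ := rfl
  have hkc : (k : ℝ) = κ := rfl
  have hfr : Module.finrank ℝ (E N) = N := by simp
  set C0 := eLpNormLESNormFDerivOfEqInnerConst (volume : Measure (E N)) (p0 : ℝ)
  set m := b - 1 / 2 with hm
  have hm0 : 0 ≤ m := by linarith
  set ω := (volume (ball (0 : E N) 1)).toReal with hω
  have hω0 : 0 ≤ ω := ENNReal.toReal_nonneg
  refine ⟨(C0 : ℝ) ^ 2 * (ω ^ m) ^ 2 + 1, by positivity, ?_⟩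
  intro a ha x₀ v hv hv0
  have hsup : Function.support v ⊆ ball x₀ a := by
    intro x hx
    by_contra h
    exact hx (hv0 x h)
  have hcs : HasCompactSupport v := by
    refine HasCompactSupport.intro (isCompact_closedBall x₀ a) ?_
    intro x hx
    exact hv0 x (fun h => hx (ball_subset_closedBall h))
  have hts : tsupport v ⊆ closedBall x₀ a :=
    closure_minimal (hsup.trans ball_subset_closedBall) isClosed_closedBall
  have h1 := eLpNorm_le_eLpNorm_fderiv_of_eq_inner (volume : Measure (E N)) (p := p0) (p' := k)
    hv hcs
    (by rw [← NNReal.coe_le_coe, hp0c]; simpa using (one_le_inv₀ hb0).2 hk4)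
    (by rw [hfr]; omega)
    (by rw [hfr, hkc, NNReal.coe_inv, hp0c, inv_inv, hb]; ring)
  have hDc : Continuous (fderiv ℝ v) := hv.continuous_fderiv (by simp)
  have hDs : HasCompactSupport (fderiv ℝ v) := hcs.fderiv (𝕜 := ℝ)
  have h2 : eLpNorm (fderiv ℝ v) p0 volume ≤ eLpNorm (fderiv ℝ v) 2 volume *
      (volume (closedBall x₀ a)) ^ m := by
    refine (aux_lpcomp (fderiv ℝ v) hDc (S := closedBall x₀ a) ?_ (p := p0) (q := 2) ?_).trans
      (le_of_eq ?_)
    · intro x hx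
      have hx' : x ∉ tsupport v := fun h => hx (hts h)
      by_contra h
      exact hx' (support_fderiv_subset ℝ h)
    · have : p0 ≤ 2 := by
        rw [← NNReal.coe_le_coe, hp0c]
        rw [inv_le_comm₀ hb0 (by norm_num)]
        simpa using hk3
      exact_mod_cast this
    · congr 1
      simp [hp0c, hm]
  have hvol : volume (closedBall x₀ a) = ENNReal.ofReal (a ^ N * ω) := by
    rw [Measure.addHaar_closedBall volume x₀ ha.le, hfr, ENNReal.ofReal_mul (by positivity), hω,
      ENNReal.ofReal_toReal measure_ball_lt_top.ne]
  have h3 := h1.trans (mul_le_mul_right h2 _)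
  have hvm : MemLp v k volume := hv.continuous.memLp_of_hasCompactSupport hcs
  have hDm : MemLp (fderiv ℝ v) 2 volume := hDc.memLp_of_hasCompactSupport hDs
  have hk0 : (k : ℝ≥0∞) ≠ 0 := by
    have : k ≠ 0 := by
      intro h
      have : (k : ℝ) = 0 := by rw [h]; rfl
      rw [hkc] at this; linarith
    exact_mod_cast this
  rw [hvm.eLpNorm_eq_integral_rpow_norm hk0 ENNReal.coe_ne_top,
    hDm.eLpNorm_eq_integral_rpow_norm (by norm_num) (by norm_num), hvol,
    ENNReal.ofReal_rpow_of_nonneg (by positivity) hm0] at h3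
  simp only [ENNReal.coe_toReal, hkc, ENNReal.toReal_ofNat, Real.rpow_ofNat] at h3
  have hC0 : (C0 : ℝ≥0∞) = ENNReal.ofReal (C0 : ℝ) := by simp
  have hI2 : 0 ≤ ∫ x, ‖fderiv ℝ v x‖ ^ 2 := integral_nonneg (fun x => by positivity)
  have hI1 : 0 ≤ ∫ x, ‖v x‖ ^ κ := integral_nonneg (fun x => by positivity)
  rw [hC0, ← ENNReal.ofReal_mul (by positivity), ← ENNReal.ofReal_mul (by positivity),
    ENNReal.ofReal_le_ofReal_iff (by positivity)] at h3
  have h4 := pow_le_pow_left₀ (by positivity) h3 2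
  have e1 : ((∫ x, ‖v x‖ ^ κ) ^ κ⁻¹) ^ 2 = (∫ x, ‖v x‖ ^ κ) ^ (2 / κ) := by
    rw [← Real.rpow_natCast, ← Real.rpow_mul hI1]
    congr 1; push_cast; field_simp
  have e2 : ((∫ x, ‖fderiv ℝ v x‖ ^ 2) ^ (2 : ℝ)⁻¹) ^ 2 = ∫ x, ‖fderiv ℝ v x‖ ^ 2 := by
    rw [← Real.rpow_natCast, ← Real.rpow_mul hI2]; norm_num
  have e3 : ((a ^ N * ω) ^ m) ^ 2 = a ^ (2 * N / κ - N + 2) * (ω ^ m) ^ 2 := by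
    rw [Real.mul_rpow (by positivity) hω0, mul_pow]
    congr 1
    rw [← Real.rpow_natCast a N, ← Real.rpow_mul ha.le, ← Real.rpow_natCast, ← Real.rpow_mul ha.le]
    congr 1
    rw [hm, hb]; push_cast; field_simp; ring
  rw [e1, mul_pow, mul_pow, e2, e3] at h4
  refine h4.trans ?_
  have : 0 ≤ a ^ (2 * N / κ - N + 2) * ∫ x, ‖fderiv ℝ v x‖ ^ 2 := by positivity
  nlinarith

theorem aux_sob2 (N : ℕ) (hN : 2 ≤ N) : ∃ CS : ℝ, 0 < CS ∧ ∀ (a : ℝ), 0 < a → ∀ (x₀ : E N)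
    (v : E N → ℝ), ContDiff ℝ 1 v → (∀ x, 0 ≤ v x) → (∀ x, x ∉ ball x₀ a → v x = 0) →
    ∫ x, v x ^ (2 * (2 - 2 / kappa N)) ≤
      CS * a ^ (2 * N / kappa N - N + 2) * (∫ x, ‖fderiv ℝ v x‖ ^ 2) *
        (∫ x, v x ^ 2) ^ (1 - 2 / kappa N) := by
  obtain ⟨CS, hCS, H⟩ := aux_sobolev N hN
  refine ⟨CS, hCS, ?_⟩
  intro a ha x₀ v hv hvn hv0
  have h1 := H a ha x₀ v hv hv0
  obtain ⟨hk2, hk3, hk4⟩ := kappa_facts N hN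
  set κ := kappa N with hκ
  have hκ0 : 0 < κ := by linarith
  have hm : 0 < 1 - 2 / κ := by
    rw [sub_pos, div_lt_one hκ0]; exact hk2
  have hcs : HasCompactSupport v := by
    refine HasCompactSupport.intro (isCompact_closedBall x₀ a) ?_
    intro x hx
    exact hv0 x (fun h => hx (ball_subset_closedBall h))
  have hc : (κ / 2).HolderConjugate (1 - 2 / κ)⁻¹ := by
    rw [Real.holderConjugate_iff]
    constructor
    · linarith
    · rw [inv_inv, inv_div]; ring
  have hvc := hv.continuous
  have hcs1 : HasCompactSupport (fun x => v x ^ 2) := by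
    refine HasCompactSupport.intro hcs.isCompact ?_
    intro x hx
    simp [image_eq_zero_of_notMem_tsupport hx]
  have hcs2 : HasCompactSupport (fun x => v x ^ (2 * (1 - 2 / κ))) := by
    refine HasCompactSupport.intro hcs.isCompact ?_
    intro x hx
    simp only [image_eq_zero_of_notMem_tsupport hx]
    rw [Real.zero_rpow (by positivity)]
  have hcont2 : Continuous (fun x => v x ^ (2 * (1 - 2 / κ))) :=
    hvc.rpow_const (fun x => Or.inr (by positivity))
  have h2 := integral_mul_le_Lp_mul_Lq_of_nonneg (μ := (volume : Measure (E N))) hc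
    (f := fun x => v x ^ 2) (g := fun x => v x ^ (2 * (1 - 2 / κ)))
    (Filter.Eventually.of_forall fun x => by simp only [Pi.zero_apply]; positivity)
    (Filter.Eventually.of_forall fun x => by
      simp only [Pi.zero_apply]; exact Real.rpow_nonneg (hvn x) _)
    ((hvc.pow 2).memLp_of_hasCompactSupport hcs1) (hcont2.memLp_of_hasCompactSupport hcs2)
  have e1 : ∀ x, v x ^ 2 * v x ^ (2 * (1 - 2 / κ)) = v x ^ (2 * (2 - 2 / κ)) := by
    intro x
    rw [← Real.rpow_natCast, ← Real.rpow_add_of_nonneg (hvn x) (by norm_num) (by positivity)]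
    congr 1; push_cast; ring
  have e2 : ∀ x, (v x ^ 2) ^ (κ / 2) = ‖v x‖ ^ κ := by
    intro x
    rw [← Real.rpow_natCast, ← Real.rpow_mul (hvn x), Real.norm_of_nonneg (hvn x)]
    congr 1; push_cast; ring
  have e3 : ∀ x, (v x ^ (2 * (1 - 2 / κ))) ^ (1 - 2 / κ)⁻¹ = v x ^ 2 := by
    intro x
    rw [← Real.rpow_mul (hvn x), ← Real.rpow_natCast]
    congr 1; push_cast; rw [mul_assoc, mul_inv_cancel₀ hm.ne']; norm_num
  simp only [e1, e2, e3, one_div, inv_inv, inv_div] at h2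
  refine h2.trans ?_
  have : 0 ≤ ∫ x, v x ^ 2 := integral_nonneg (fun x => by positivity)
  gcongr

theorem aux_ST : ∃ c : ℝ, 1 ≤ c ∧ ∀ x, |deriv Real.smoothTransition x| ≤ c := by
  have hc : Continuous (deriv Real.smoothTransition) :=
    (Real.smoothTransition.contDiff (n := 1)).continuous_deriv (by simp)
  have hs : HasCompactSupport (deriv Real.smoothTransition) := by
    refine HasCompactSupport.intro (isCompact_Icc (a := (0 : ℝ)) (b := 1)) ?_
    intro x hx
    rw [mem_Icc, not_and_or, not_le, not_le] at hx
    rcases hx with hx | hx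
    · have : Real.smoothTransition =ᶠ[nhds x] fun _ => 0 := by
        filter_upwards [Iio_mem_nhds hx] with y hy
        exact Real.smoothTransition.zero_of_nonpos (le_of_lt hy)
      rw [this.deriv_eq]; simp
    · have : Real.smoothTransition =ᶠ[nhds x] fun _ => 1 := by
        filter_upwards [Ioi_mem_nhds hx] with y hy
        exact Real.smoothTransition.one_of_one_le (le_of_lt hy)
      rw [this.deriv_eq]; simp
  obtain ⟨c, hc'⟩ := hc.bounded_above_of_compact_support hs
  refine ⟨max c 1, le_max_right _ _, fun x => ?_⟩
  exact (hc' x).trans (le_max_left _ _)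

def cST : ℝ := Classical.choose aux_ST
theorem cST_one : 1 ≤ cST := (Classical.choose_spec aux_ST).1
theorem cST_deriv (x : ℝ) : |deriv Real.smoothTransition x| ≤ cST :=
  (Classical.choose_spec aux_ST).2 x

theorem ST_diff : Differentiable ℝ Real.smoothTransition :=
  (Real.smoothTransition.contDiff (n := 1)).differentiable (by simp)

theorem ST_lip (x y : ℝ) :
    |Real.smoothTransition x - Real.smoothTransition y| ≤ cST * |x - y| := by
  have := Convex.norm_image_sub_le_of_norm_deriv_le (f := Real.smoothTransition) (C := cST)
    (s := univ) (x := y) (y := x) (fun x _ => ST_diff x) (fun x _ => cST_deriv x) convex_univ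
    (mem_univ _) (mem_univ _)
  simpa using this

theorem ST_deriv_nonneg (x : ℝ) : 0 ≤ deriv Real.smoothTransition x :=
  Real.smoothTransition.monotone.deriv_nonneg

theorem ST_deriv_zero {x : ℝ} (hx : x < 0 ∨ 1 < x) : deriv Real.smoothTransition x = 0 := by
  rcases hx with hx | hx
  · have : Real.smoothTransition =ᶠ[nhds x] fun _ => 0 := by
      filter_upwards [Iio_mem_nhds hx] with y hy
      exact Real.smoothTransition.zero_of_nonpos (le_of_lt hy)
    rw [this.deriv_eq]; simp
  · have : Real.smoothTransition =ᶠ[nhds x] fun _ => 1 := by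
      filter_upwards [Ioi_mem_nhds hx] with y hy
      exact Real.smoothTransition.one_of_one_le (le_of_lt hy)
    rw [this.deriv_eq]; simp

theorem aux_cutoff {N : ℕ} (x₀ : E N) {b a : ℝ} (hb : 0 < b) (hba : b < a) :
    ∃ ψ : E N → ℝ, ContDiff ℝ (⊤ : ℕ∞) ψ ∧ (∀ x, 0 ≤ ψ x) ∧ (∀ x, ψ x ≤ 1) ∧
      (∀ x ∈ ball x₀ b, ψ x = 1) ∧ (∀ x, x ∉ ball x₀ a → ψ x = 0) ∧
      (∀ x y, |ψ x - ψ y| ≤ cST / (a - b) * ‖x - y‖) ∧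
      (∀ x, ‖fderiv ℝ ψ x‖ ≤ cST / (a - b)) := by
  have hab : 0 < a - b := by linarith
  have hc0 : 0 ≤ cST := by linarith [cST_one]
  set ψ : E N → ℝ := fun x => Real.smoothTransition ((a - ‖x - x₀‖) / (a - b)) with hψ
  have h1 : ∀ x ∈ ball x₀ b, ψ x = 1 := by
    intro x hx
    apply Real.smoothTransition.one_of_one_le
    rw [mem_ball, dist_eq_norm] at hx
    rw [le_div_iff₀ hab]; linarith
  have hlip : ∀ x y, |ψ x - ψ y| ≤ cST / (a - b) * ‖x - y‖ := by
    intro x y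
    refine (ST_lip _ _).trans ?_
    have : (a - ‖x - x₀‖) / (a - b) - (a - ‖y - x₀‖) / (a - b) =
      (‖y - x₀‖ - ‖x - x₀‖) / (a - b) := by ring
    rw [this, abs_div, abs_of_pos hab, div_mul_eq_mul_div, mul_div_assoc]
    gcongr
    refine (abs_norm_sub_norm_le _ _).trans ?_
    rw [sub_sub_sub_cancel_right, norm_sub_rev]
  refine ⟨ψ, ?_, fun x => Real.smoothTransition.nonneg _, fun x => Real.smoothTransition.le_one _,
    h1, ?_, hlip, ?_⟩
  · rw [contDiff_iff_contDiffAt]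
    intro x
    by_cases hx : x = x₀
    · have : ψ =ᶠ[nhds x] fun _ => 1 := by
        filter_upwards [isOpen_ball.mem_nhds (by rw [hx]; exact mem_ball_self hb :
          x ∈ ball x₀ b)] with y hy
        exact h1 y hy
      exact contDiffAt_const.congr_of_eventuallyEq this
    · have hn : ContDiffAt ℝ (⊤ : ℕ∞) (fun x => ‖x - x₀‖) x :=
        (contDiffAt_id.sub contDiffAt_const).norm ℝ (sub_ne_zero.2 hx)
      exact Real.smoothTransition.contDiffAt.comp x ((contDiffAt_const.sub hn).div_const _)
  · intro x hx
    apply Real.smoothTransition.zero_of_nonpos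
    rw [mem_ball, dist_eq_norm, not_lt] at hx
    exact div_nonpos_of_nonpos_of_nonneg (by linarith) hab.le
  · intro x
    have hL : LipschitzWith ⟨cST / (a - b), by positivity⟩ ψ := by
      apply LipschitzWith.of_dist_le_mul
      intro x y
      rw [Real.dist_eq, dist_eq_norm]
      exact hlip x y
    exact norm_fderiv_le_of_lipschitz ℝ hL

theorem aux_ramp {F G H : ℝ → ℝ} (hF : Continuous F) (hG : Continuous G) (hH : Continuous H)
    (hF0 : ∀ t, 0 ≤ F t) (hFH : ∀ t, F t ≤ H t) {C p τ0 τ1 τm τ2 a b : ℝ}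
    (hC : 0 ≤ C) (h0 : τ0 < a) (hab : a < b) (h1 : b ≤ τ1) (h2 : τ1 < τm) (h3 : τm < τ2)
    (hη : ∀ η : ℝ → ℝ, ContDiff ℝ (⊤ : ℕ∞) η → (∀ t, 0 ≤ η t) → tsupport η ⊆ Ioo τ0 τ2 →
      (∫ t, deriv η t * F t) + (1 - p) * (∫ t, η t * G t) ≤ C * ∫ t, η t * H t) :
    ∃ ρ η : ℝ → ℝ, Continuous ρ ∧ Continuous η ∧ (∀ t, 0 ≤ ρ t) ∧ (∀ t, t ∉ Icc a b → ρ t = 0) ∧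
      (∫ t, ρ t = 1) ∧ (∀ t, 0 ≤ η t) ∧ (∀ t ∈ Ioo b τ1, η t = 1) ∧
      (∀ t, t ∉ Icc a τm → η t = 0) ∧
      (∫ t, ρ t * F t) + (1 - p) * (∫ t, η t * G t) ≤
        (C + cST / (τm - τ1)) * ∫ t in Ioo τ0 τ2, H t := by
  have hba : 0 < b - a := by linarith
  have hm : 0 < τm - τ1 := by linarith
  have hc0 : 0 ≤ cST := by linarith [cST_one]
  set S := Real.smoothTransition with hS
  have hSs : ContDiff ℝ (⊤ : ℕ∞) S := Real.smoothTransition.contDiff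
  have hSdc : Continuous (deriv S) := hSs.continuous_deriv (by simp)
  set X : ℝ → ℝ := fun t => S ((t - a) / (b - a)) with hX
  set Z : ℝ → ℝ := fun t => S ((τm - t) / (τm - τ1)) with hZ
  set ρ : ℝ → ℝ := fun t => deriv S ((t - a) / (b - a)) * (1 / (b - a)) with hρ
  set ζ : ℝ → ℝ := fun t => deriv S ((τm - t) / (τm - τ1)) * (-1 / (τm - τ1)) with hζ
  have dX : ∀ t, HasDerivAt X (ρ t) t := by
    intro t
    exact (ST_diff _).hasDerivAt.comp t (((hasDerivAt_id t).sub_const a).div_const (b - a))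
  have dZ : ∀ t, HasDerivAt Z (ζ t) t := by
    intro t
    exact (ST_diff _).hasDerivAt.comp t (((hasDerivAt_id t).const_sub τm).div_const (τm - τ1))
  have hXs : ContDiff ℝ (⊤ : ℕ∞) X := hSs.comp (by fun_prop)
  have hZs : ContDiff ℝ (⊤ : ℕ∞) Z := hSs.comp (by fun_prop)
  have hρc : Continuous ρ := by
    apply Continuous.mul _ continuous_const
    exact hSdc.comp (by fun_prop)
  have hζc : Continuous ζ := by
    apply Continuous.mul _ continuous_const
    exact hSdc.comp (by fun_prop)
  have hρ0 : ∀ t, 0 ≤ ρ t := fun t => mul_nonneg (ST_deriv_nonneg _) (by positivity)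
  have hρz : ∀ t, t ∉ Icc a b → ρ t = 0 := by
    intro t ht
    have : deriv S ((t - a) / (b - a)) = 0 := by
      apply ST_deriv_zero
      rw [mem_Icc, not_and_or, not_le, not_le] at ht
      rcases ht with ht | ht
      · left; exact div_neg_of_neg_of_pos (by linarith) hba
      · right; rw [lt_div_iff₀ hba]; linarith
    simp [hρ, this]
  have hX0 : ∀ t, 0 ≤ X t := fun t => Real.smoothTransition.nonneg _
  have hX1 : ∀ t, X t ≤ 1 := fun t => Real.smoothTransition.le_one _
  have hZ0 : ∀ t, 0 ≤ Z t := fun t => Real.smoothTransition.nonneg _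
  have hZ1 : ∀ t, Z t ≤ 1 := fun t => Real.smoothTransition.le_one _
  have hZone : ∀ t, t ≤ τ1 → Z t = 1 := by
    intro t ht
    apply Real.smoothTransition.one_of_one_le
    rw [le_div_iff₀ hm]; linarith
  have hXone : ∀ t, b ≤ t → X t = 1 := by
    intro t ht
    apply Real.smoothTransition.one_of_one_le
    rw [le_div_iff₀ hba]; linarith
  have hXz : ∀ t, t ≤ a → X t = 0 := by
    intro t ht
    apply Real.smoothTransition.zero_of_nonpos
    exact div_nonpos_of_nonpos_of_nonneg (by linarith) hba.le
  have hZz : ∀ t, τm ≤ t → Z t = 0 := by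
    intro t ht
    apply Real.smoothTransition.zero_of_nonpos
    exact div_nonpos_of_nonpos_of_nonneg (by linarith) hm.le
  have hζz : ∀ t, τm < t → ζ t = 0 := by
    intro t ht
    have : deriv S ((τm - t) / (τm - τ1)) = 0 := by
      apply ST_deriv_zero
      left; exact div_neg_of_neg_of_pos (by linarith) hm
    simp [hζ, this]
  have hζb : ∀ t, |ζ t| ≤ cST / (τm - τ1) := by
    intro t
    have : |(-1 : ℝ) / (τm - τ1)| = 1 / (τm - τ1) := by
      rw [neg_div, abs_neg, abs_of_pos (by positivity)]
    rw [hζ, abs_mul, this, mul_one_div]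
    gcongr
    exact cST_deriv _
  have hηz : ∀ t, t ∉ Icc a τm → X t * Z t = 0 := by
    intro t ht
    rw [mem_Icc, not_and_or, not_le, not_le] at ht
    rcases ht with ht | ht
    · rw [hXz t ht.le, zero_mul]
    · rw [hZz t ht.le, mul_zero]
  have hIc : Icc a τm ⊆ Ioo τ0 τ2 := fun t ht => ⟨by linarith [ht.1], by linarith [ht.2]⟩
  have key := hη (fun t => X t * Z t) (hXs.mul hZs) (fun t => mul_nonneg (hX0 t) (hZ0 t))
    ((closure_minimal (by
      intro t ht
      by_contra h
      exact ht (hηz t h)) isClosed_Icc).trans hIc)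
  have hd : ∀ t, deriv (fun t => X t * Z t) t = ρ t + X t * ζ t := by
    intro t
    have hdm : HasDerivAt (fun t => X t * Z t) (ρ t * Z t + X t * ζ t) t := (dX t).mul (dZ t)
    rw [hdm.deriv]
    by_cases h : t ∈ Icc a b
    · rw [hZone t (h.2.trans h1), mul_one]
    · rw [hρz t h]; ring
  simp only [hd] at key
  have iH : Integrable ((Ioo τ0 τ2).indicator H) :=
    (integrable_indicator_iff measurableSet_Ioo).2
      ((hH.integrableOn_Icc (a := τ0) (b := τ2)).mono_set Ioo_subset_Icc_self)
  have ccs : ∀ f : ℝ → ℝ, Continuous f → (∀ t, t ∉ Icc a τm → f t = 0) → Integrable f := by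
    intro f hf hz
    exact hf.integrable_of_hasCompactSupport (HasCompactSupport.intro isCompact_Icc (fun t => hz t))
  have hXζ : ∀ t, t ∉ Icc a τm → X t * ζ t = 0 := by
    intro t ht
    rw [mem_Icc, not_and_or, not_le, not_le] at ht
    rcases ht with ht | ht
    · rw [hXz t ht.le, zero_mul]
    · rw [hζz t ht, mul_zero]
  have hρz' : ∀ t, t ∉ Icc a τm → ρ t = 0 := by
    intro t ht
    exact hρz t (fun h => ht ⟨h.1, by linarith [h.2]⟩)
  have i1 : Integrable (fun t => ρ t * F t) :=
    ccs _ (hρc.mul hF) (fun t ht => by rw [hρz' t ht, zero_mul])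
  have i2 : Integrable (fun t => X t * ζ t * F t) :=
    ccs _ ((hXs.continuous.mul hζc).mul hF) (fun t ht => by rw [hXζ t ht, zero_mul])
  have e1 : (∫ t, (ρ t + X t * ζ t) * F t) = (∫ t, ρ t * F t) + ∫ t, X t * ζ t * F t := by
    rw [← integral_add i1 i2]
    congr 1; ext t; ring
  have b1 : -(∫ t, X t * ζ t * F t) ≤ cST / (τm - τ1) * ∫ t in Ioo τ0 τ2, H t := by
    rw [← integral_indicator measurableSet_Ioo, ← integral_const_mul, ← integral_neg]
    apply integral_mono i2.neg (iH.const_mul _)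
    intro t
    show -(X t * ζ t * F t) ≤ cST / (τm - τ1) * (Ioo τ0 τ2).indicator H t
    by_cases h : t ∈ Icc a τm
    · rw [indicator_of_mem (hIc h)]
      have h5 : -(X t * ζ t) ≤ cST / (τm - τ1) := by
        refine (neg_le_abs _).trans ?_
        rw [abs_mul, abs_of_nonneg (hX0 t)]
        calc X t * |ζ t| ≤ 1 * |ζ t| := by gcongr; exact hX1 t
          _ ≤ _ := by rw [one_mul]; exact hζb t
      calc -(X t * ζ t * F t) = -(X t * ζ t) * F t := by ring
        _ ≤ cST / (τm - τ1) * F t := by gcongr; exact hF0 t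
        _ ≤ _ := by gcongr; exact hFH t
    · rw [hXζ t h]
      simp only [zero_mul, neg_zero]
      exact mul_nonneg (by positivity) (indicator_nonneg (fun t _ => (hF0 t).trans (hFH t)) t)
  have b2 : (∫ t, X t * Z t * H t) ≤ ∫ t in Ioo τ0 τ2, H t := by
    rw [← integral_indicator measurableSet_Ioo]
    apply integral_mono (ccs (fun t => X t * Z t * H t) ((hXs.continuous.mul hZs.continuous).mul hH)
      (fun t ht => by rw [hηz t ht, zero_mul])) iH
    intro t
    dsimp only
    by_cases h : t ∈ Icc a τm
    · rw [indicator_of_mem (hIc h)]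
      have : X t * Z t ≤ 1 := mul_le_one₀ (hX1 t) (hZ0 t) (hZ1 t)
      have hH0 := (hF0 t).trans (hFH t)
      nlinarith
    · rw [hηz t h, zero_mul]
      exact indicator_nonneg (fun t _ => (hF0 t).trans (hFH t)) t
  refine ⟨ρ, fun t => X t * Z t, hρc, hXs.continuous.mul hZs.continuous, hρ0, hρz, ?_,
    fun t => mul_nonneg (hX0 t) (hZ0 t), ?_, hηz, ?_⟩
  · have : ∫ t, ρ t = ∫ t in Icc a b, ρ t :=
      (setIntegral_eq_integral_of_forall_compl_eq_zero (fun t ht => hρz t ht)).symm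
    rw [this, integral_Icc_eq_integral_Ioc, ← intervalIntegral.integral_of_le hab.le,
      intervalIntegral.integral_eq_sub_of_hasDerivAt (fun t _ => dX t) (hρc.intervalIntegrable _ _),
      hXone b le_rfl, hXz a le_rfl, sub_zero]
  · intro t ht
    dsimp only
    rw [hXone t ht.1.le, hZone t ht.2.le, one_mul]
  · rw [e1] at key
    have := mul_le_mul_of_nonneg_left b2 hC
    linarith

/-- pure ODE-type lemma -/
theorem aux_ode {F G H : ℝ → ℝ} (hF : Continuous F) (hG : Continuous G) (hH : Continuous H)
    (hF0 : ∀ t, 0 ≤ F t) (hG0 : ∀ t, 0 ≤ G t) (hFH : ∀ t, F t ≤ H t) {C p τ0 τ τ1 τm τ2 : ℝ}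
    (hp : p < 1) (hC : 0 ≤ C) (h0 : τ0 < τ) (h1 : τ ≤ τ1) (h2 : τ1 < τm) (h3 : τm < τ2)
    (hη : ∀ η : ℝ → ℝ, ContDiff ℝ (⊤ : ℕ∞) η → (∀ t, 0 ≤ η t) → tsupport η ⊆ Ioo τ0 τ2 →
      (∫ t, deriv η t * F t) + (1 - p) * (∫ t, η t * G t) ≤ C * ∫ t, η t * H t) :
    (∀ t ∈ Ico τ τ1, F t ≤ (C + cST / (τm - τ1)) * ∫ t in Ioo τ0 τ2, H t) ∧
    (1 - p) * (∫ t in Ioo τ τ1, G t) ≤ (C + cST / (τm - τ1)) * ∫ t in Ioo τ0 τ2, H t := by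
  set A := (C + cST / (τm - τ1)) * ∫ t in Ioo τ0 τ2, H t with hA
  constructor
  · intro a ha
    by_contra hcon
    push Not at hcon
    have hnb : ∀ᶠ t in nhds a, (A + F a) / 2 < F t :=
      hF.continuousAt.eventually (lt_mem_nhds (by linarith))
    obtain ⟨ε, hε, hball⟩ := Metric.eventually_nhds_iff.1 hnb
    set b := min (a + ε / 2) τ1 with hb
    have hab : a < b := lt_min (by linarith) ha.2
    obtain ⟨ρ, η, hρc, hηc, hρ0, hρz, hρ1, hη0, -, -, h⟩ := aux_ramp hF hG hH hF0 hFH hC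
      (lt_of_lt_of_le h0 ha.1) hab (min_le_right _ _) h2 h3 hη
    have g0 : 0 ≤ (1 - p) * (∫ t, η t * G t) :=
      mul_nonneg (by linarith) (integral_nonneg fun t => mul_nonneg (hη0 t) (hG0 t))
    have ics : ∀ f : ℝ → ℝ, Continuous f → Integrable (fun t => ρ t * f t) := by
      intro f hf
      exact (hρc.mul hf).integrable_of_hasCompactSupport
        (HasCompactSupport.intro (isCompact_Icc (a := a) (b := b))
          (fun t ht => by rw [Pi.mul_apply, hρz t ht, zero_mul]))
    have : (A + F a) / 2 ≤ ∫ t, ρ t * F t := by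
      calc (A + F a) / 2 = ∫ t, ρ t * ((A + F a) / 2) := by
            rw [integral_mul_const, hρ1, one_mul]
        _ ≤ _ := by
            apply integral_mono (ics _ continuous_const) (ics _ hF)
            intro t
            dsimp only
            by_cases ht : t ∈ Icc a b
            · apply mul_le_mul_of_nonneg_left _ (hρ0 t)
              apply le_of_lt
              apply hball
              rw [Real.dist_eq, abs_of_nonneg (by linarith [ht.1])]
              have := ht.2.trans (min_le_left _ _)
              linarith
            · rw [hρz t ht]; simp
    linarith
  · obtain ⟨ρ, η, hρc, hηc, hρ0, hρz, hρ1, hη0, hη1, hηz, h⟩ := aux_ramp (a := (τ0 + τ) / 2) (b := τ)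
      hF hG hH hF0 hFH hC (by linarith) (by linarith) h1 h2 h3 hη
    have f0 : 0 ≤ ∫ t, ρ t * F t := integral_nonneg fun t => mul_nonneg (hρ0 t) (hF0 t)
    have : ∫ t in Ioo τ τ1, G t ≤ ∫ t, η t * G t := by
      rw [← integral_indicator measurableSet_Ioo]
      apply integral_mono
      · exact (integrable_indicator_iff measurableSet_Ioo).2
          ((hG.integrableOn_Icc (a := τ) (b := τ1)).mono_set Ioo_subset_Icc_self)
      · exact (hηc.mul hG).integrable_of_hasCompactSupport
          (HasCompactSupport.intro (isCompact_Icc (a := (τ0 + τ) / 2) (b := τm))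
            (fun t ht => by rw [Pi.mul_apply, hηz t ht, zero_mul]))
      · intro t
        dsimp only
        by_cases ht : t ∈ Ioo τ τ1
        · rw [indicator_of_mem ht, hη1 t ht, one_mul]
        · rw [indicator_of_notMem ht]; exact mul_nonneg (hη0 t) (hG0 t)
    have := mul_le_mul_of_nonneg_left this (by linarith : 0 ≤ 1 - p)
    linarith

theorem aux_ext {N : ℕ} {u : E N → ℝ → ℝ} {x₀ : E N} {R l ta tb τ0 τ2 : ℝ} (hR : 0 < R) (hl : 0 < l)
    (h0 : ta < τ0) (h1 : τ0 < τ2) (h2 : τ2 < tb)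
    (hu : ContDiffOn ℝ (⊤ : ℕ∞) (fun p : E N × ℝ => u p.1 p.2) (ball x₀ R ×ˢ Ioo ta tb))
    (hu0 : ∀ x ∈ ball x₀ R, ∀ t ∈ Ioo ta tb, 0 ≤ u x t) :
    ∃ W : E N → ℝ → ℝ, ContDiff ℝ (⊤ : ℕ∞) (fun z : E N × ℝ => W z.1 z.2) ∧
      (∀ x t, 0 < W x t) ∧ ∀ x ∈ ball x₀ (R / 2), ∀ t ∈ Ioo τ0 τ2, W x t = u x t + l := by
  set c1 : ContDiffBump x₀ := ⟨R / 2, 3 * R / 4, by linarith, by linarith⟩ with hc1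
  set m := min (τ0 - ta) (tb - τ2) / 2 with hm
  have hm0 : 0 < m := by
    have : 0 < min (τ0 - ta) (tb - τ2) := lt_min (by linarith) (by linarith)
    linarith
  have hma : m < τ0 - ta := by
    have := min_le_left (τ0 - ta) (tb - τ2)
    linarith
  have hmb : m < tb - τ2 := by
    have := min_le_right (τ0 - ta) (tb - τ2)
    linarith
  set c2 : ContDiffBump ((τ0 + τ2) / 2) := ⟨(τ2 - τ0) / 2, (τ2 - τ0) / 2 + m, by linarith,
    by linarith⟩ with hc2
  have hsub : closedBall x₀ (3 * R / 4) ×ˢ closedBall ((τ0 + τ2) / 2) ((τ2 - τ0) / 2 + m) ⊆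
      ball x₀ R ×ˢ Ioo ta tb := by
    apply prod_mono
    · exact closedBall_subset_ball (by linarith)
    · intro t ht
      rw [mem_closedBall, Real.dist_eq, abs_le] at ht
      constructor <;> linarith [ht.1, ht.2]
  have z1 : ∀ x, x ∉ closedBall x₀ (3 * R / 4) → c1 x = 0 := by
    intro x hx
    apply c1.zero_of_le_dist
    rw [mem_closedBall, not_le] at hx
    exact hx.le
  have z2 : ∀ t, t ∉ closedBall ((τ0 + τ2) / 2) ((τ2 - τ0) / 2 + m) → c2 t = 0 := by
    intro x hx
    apply c2.zero_of_le_dist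
    rw [mem_closedBall, not_le] at hx
    exact hx.le
  refine ⟨fun x t => c1 x * c2 t * (u x t + l) + (1 - c1 x * c2 t), ?_, ?_, ?_⟩
  · rw [contDiff_iff_contDiffAt]
    intro z
    by_cases hz : z ∈ ball x₀ R ×ˢ Ioo ta tb
    · have hu' := hu.contDiffAt ((isOpen_ball.prod isOpen_Ioo).mem_nhds hz)
      have a1 : ContDiffAt ℝ (⊤ : ℕ∞) (fun z : E N × ℝ => c1 z.1) z :=
        c1.contDiff.contDiffAt.comp z contDiffAt_fst
      have a2 : ContDiffAt ℝ (⊤ : ℕ∞) (fun z : E N × ℝ => c2 z.2) z :=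
        c2.contDiff.contDiffAt.comp z contDiffAt_snd
      exact ((a1.mul a2).mul (hu'.add contDiffAt_const)).add (contDiffAt_const.sub (a1.mul a2))
    · have hz' : z ∈ (closedBall x₀ (3 * R / 4) ×ˢ
        closedBall ((τ0 + τ2) / 2) ((τ2 - τ0) / 2 + m))ᶜ := fun h => hz (hsub h)
      have : (fun z : E N × ℝ => c1 z.1 * c2 z.2 * (u z.1 z.2 + l) + (1 - c1 z.1 * c2 z.2))
          =ᶠ[nhds z] fun _ => 1 := by
        filter_upwards [(isClosed_closedBall.prod isClosed_closedBall).isOpen_compl.mem_nhds hz']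
          with y hy
        have : c1 y.1 * c2 y.2 = 0 := by
          rw [mem_compl_iff, mem_prod, not_and_or] at hy
          rcases hy with hy | hy
          · rw [z1 _ hy, zero_mul]
          · rw [z2 _ hy, mul_zero]
        rw [this]; simp
      exact contDiffAt_const.congr_of_eventuallyEq this
  · intro x t
    beta_reduce
    have b1 : 0 ≤ c1 x * c2 t := mul_nonneg c1.nonneg c2.nonneg
    have b2 : c1 x * c2 t ≤ 1 := mul_le_one₀ c1.le_one c2.nonneg c2.le_one
    by_cases hz : (x, t) ∈ ball x₀ R ×ˢ Ioo ta tb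
    · have := hu0 x hz.1 t hz.2
      have h3 : 0 ≤ c1 x * c2 t * u x t := mul_nonneg b1 this
      rcases b2.lt_or_eq with h | h
      · nlinarith [mul_nonneg b1 hl.le]
      · rw [h]; linarith
    · have : c1 x * c2 t = 0 := by
        have hz' : ¬ ((x, t) ∈ closedBall x₀ (3 * R / 4) ×ˢ
          closedBall ((τ0 + τ2) / 2) ((τ2 - τ0) / 2 + m)) := fun h => hz (hsub h)
        rw [mem_prod, not_and_or] at hz'
        rcases hz' with hy | hy
        · rw [z1 _ hy, zero_mul]
        · rw [z2 _ hy, mul_zero]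
      rw [this]; simp
  · intro x hx t ht
    beta_reduce
    have b1 : c1 x = 1 := c1.one_of_mem_closedBall (ball_subset_closedBall hx)
    have b2 : c2 t = 1 := by
      apply c2.one_of_mem_closedBall
      rw [mem_closedBall, Real.dist_eq, abs_le]
      constructor <;> simp only [hc2] <;> linarith [ht.1, ht.2]
    rw [b1, b2]; ring

theorem aux_tailker (N : ℕ) (hN : 2 ≤ N) (s : ℝ) (hs : s ∈ Set.Ioo (0 : ℝ) 1) (x₀ : E N) {R : ℝ}
    (hR : 0 < R) : IntegrableOn (fun y : E N => ‖y - x₀‖ ^ (-((N : ℝ) + 2 * s))) (ball x₀ R)ᶜ := by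
  have h0 := ((aux_kernel_int N hN s hs).comp_sub_right x₀).const_mul (min 1 (R ^ 2))⁻¹
  refine (h0.integrableOn (s := (ball x₀ R)ᶜ)).mono' ?_ ?_
  · exact (Measurable.pow_const (by fun_prop) _).aestronglyMeasurable
  · rw [ae_restrict_iff' measurableSet_ball.compl]
    refine Filter.Eventually.of_forall fun y hy => ?_
    rw [mem_compl_iff, mem_ball, dist_eq_norm, not_lt] at hy
    have hm : 0 < min 1 (R ^ 2) := lt_min one_pos (by positivity)
    rw [Real.norm_of_nonneg (by positivity), ← mul_assoc]
    refine le_mul_of_one_le_left (by positivity) ?_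
    rw [inv_mul_eq_div, le_div_iff₀ hm, one_mul]
    exact min_le_min le_rfl (by gcongr)

theorem aux_tail (N : ℕ) (hN : 2 ≤ N) (s : ℝ) (hs : s ∈ Set.Ioo (0 : ℝ) 1) {u : E N → ℝ → ℝ}
    {T M₀ R r t₀ : ℝ} {x₀ : E N} (hum : Measurable (fun p : E N × ℝ => u p.1 p.2))
    (hub : ∀ x t, t ∈ Set.Ioo 0 T → |u x t| ≤ M₀) (hI : Set.Ioo t₀ (t₀ + r ^ 2) ⊆ Set.Ioo 0 T)
    (hu0 : ∀ x ∈ Metric.ball x₀ R, ∀ t ∈ Set.Ioo t₀ (t₀ + r ^ 2), 0 ≤ u x t)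
    (hr : 0 < r) (hrR : r < R / 2) :
    0 ≤ tailInfty N s (uminus N u) x₀ R t₀ (t₀ + r ^ 2) ∧
    ∀ᵐ t, t ∈ Set.Ioo t₀ (t₀ + r ^ 2) → ∀ x ∈ ball x₀ r,
      Integrable (fun y => uminus N u y t * ‖x - y‖ ^ (-((N : ℝ) + 2 * s))) ∧
      ∫ y, uminus N u y t * ‖x - y‖ ^ (-((N : ℝ) + 2 * s)) ≤
        2 ^ (N + 2) / r ^ 2 * ((r / R) ^ 2 * tailInfty N s (uminus N u) x₀ R t₀ (t₀ + r ^ 2)) := by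
  have hR : 0 < R := by linarith
  have hs0 := hs.1
  have hs1 := hs.2
  have hker := aux_tailker N hN s hs x₀ hR
  set f : ℝ → ℝ := fun t => ∫ y in (Metric.ball x₀ R)ᶜ,
    |uminus N u y t| * ‖y - x₀‖ ^ (-((N : ℝ) + 2 * s)) with hf
  have hg0 : ∀ y t, 0 ≤ uminus N u y t := fun y t => le_max_right _ _
  have hgM : ∀ y t, t ∈ Ioo t₀ (t₀ + r ^ 2) → |uminus N u y t| ≤ M₀ := by
    intro y t ht
    have := hub y t (hI ht)
    rw [abs_of_nonneg (hg0 y t)]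
    exact max_le ((neg_le_abs _).trans this) ((abs_nonneg _).trans this)
  have hgm : ∀ t, Measurable (fun y => uminus N u y t) := by
    intro t
    have : Measurable (fun y => u y t) := 
      hum.comp (measurable_id.prodMk measurable_const : Measurable fun y : E N => (y, t))
    exact this.neg.max measurable_const
  have hint : ∀ t, t ∈ Ioo t₀ (t₀ + r ^ 2) → IntegrableOn (fun y =>
      |uminus N u y t| * ‖y - x₀‖ ^ (-((N : ℝ) + 2 * s))) (ball x₀ R)ᶜ := by
    intro t ht
    refine Integrable.bdd_mul (c := M₀) hker ?_ ?_
    · exact (hgm t).norm.aestronglyMeasurable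
    · refine Filter.Eventually.of_forall fun y => ?_
      rw [Real.norm_eq_abs, abs_abs]
      exact hgM y t ht
  have hf0 : ∀ t, 0 ≤ f t := fun t => integral_nonneg fun y => by positivity
  have hfb : ∀ t, t ∈ Ioo t₀ (t₀ + r ^ 2) → f t ≤ ∫ y in (Metric.ball x₀ R)ᶜ,
      M₀ * ‖y - x₀‖ ^ (-((N : ℝ) + 2 * s)) := by
    intro t ht
    apply integral_mono (hint t ht) (hker.const_mul M₀)
    intro y
    dsimp only
    gcongr
    exact hgM y t ht
  have hae : ∀ᵐ t ∂(volume.restrict (Ioo t₀ (t₀ + r ^ 2))),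
      f t ≤ essSup f (volume.restrict (Ioo t₀ (t₀ + r ^ 2))) := by
    apply ae_le_essSup
    refine ⟨∫ y in (Metric.ball x₀ R)ᶜ, M₀ * ‖y - x₀‖ ^ (-((N : ℝ) + 2 * s)), ?_⟩
    rw [Filter.eventually_map]
    exact (ae_restrict_iff' measurableSet_Ioo).2 (Filter.Eventually.of_forall hfb)
  have htl : tailInfty N s (uminus N u) x₀ R t₀ (t₀ + r ^ 2) = R ^ 2 *
    essSup f (volume.restrict (Ioo t₀ (t₀ + r ^ 2))) := rfl
  constructor
  · rw [htl]
    apply mul_nonneg (by positivity)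
    have hne : (volume.restrict (Ioo t₀ (t₀ + r ^ 2))) ≠ 0 := by
      rw [Ne, Measure.restrict_eq_zero, Real.volume_Ioo]
      simp; positivity
    have : (ae (volume.restrict (Ioo t₀ (t₀ + r ^ 2)))).NeBot := ae_neBot.2 hne
    obtain ⟨t, ht⟩ := hae.exists
    exact (hf0 t).trans ht
  · rw [ae_restrict_iff' measurableSet_Ioo] at hae
    filter_upwards [hae] with t ht htI x hx
    have h1 := ht htI
    rw [mem_ball, dist_eq_norm] at hx
    have hle : ∀ y ∈ (ball x₀ R)ᶜ, ‖x - y‖ ^ (-((N : ℝ) + 2 * s)) ≤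
        2 ^ (N + 2) * ‖y - x₀‖ ^ (-((N : ℝ) + 2 * s)) := by
      intro y hy
      rw [mem_compl_iff, mem_ball, dist_eq_norm, not_lt] at hy
      have h2 : ‖y - x₀‖ / 2 ≤ ‖x - y‖ := by
        have : ‖y - x₀‖ ≤ ‖x - y‖ + ‖x - x₀‖ := by
          have e : y - x₀ = (x - x₀) - (x - y) := by abel
          rw [e, add_comm]
          exact norm_sub_le _ _
        linarith
      have h3 : 0 < ‖y - x₀‖ / 2 := by linarith
      calc ‖x - y‖ ^ (-((N : ℝ) + 2 * s)) ≤ (‖y - x₀‖ / 2) ^ (-((N : ℝ) + 2 * s)) :=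
            Real.rpow_le_rpow_of_nonpos h3 h2 (by
              have : (0:ℝ) ≤ N := Nat.cast_nonneg _
              linarith)
        _ = 2 ^ ((N : ℝ) + 2 * s) * ‖y - x₀‖ ^ (-((N : ℝ) + 2 * s)) := by
            rw [Real.div_rpow (by positivity) (by norm_num), Real.rpow_neg (by norm_num : (0:ℝ) ≤ 2)]
            field_simp
        _ ≤ _ := by
            gcongr
            rw [← Real.rpow_natCast]
            apply Real.rpow_le_rpow_of_exponent_le (by norm_num)
            push_cast
            linarith
    have hz : ∀ y, y ∉ (ball x₀ R)ᶜ → uminus N u y t * ‖x - y‖ ^ (-((N : ℝ) + 2 * s)) = 0 := by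
      intro y hy
      rw [notMem_compl_iff] at hy
      have := hu0 y hy t htI
      have : uminus N u y t = 0 := max_eq_right (by linarith)
      rw [this, zero_mul]
    have hle2 : ∀ y ∈ (ball x₀ R)ᶜ, uminus N u y t * ‖x - y‖ ^ (-((N : ℝ) + 2 * s)) ≤
        2 ^ (N + 2) * (|uminus N u y t| * ‖y - x₀‖ ^ (-((N : ℝ) + 2 * s))) := by
      intro y hy
      rw [abs_of_nonneg (hg0 y t)]
      calc _ ≤ uminus N u y t * (2 ^ (N + 2) * ‖y - x₀‖ ^ (-((N : ℝ) + 2 * s))) :=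
            mul_le_mul_of_nonneg_left (hle y hy) (hg0 y t)
        _ = _ := by ring
    have hi : IntegrableOn (fun y => uminus N u y t * ‖x - y‖ ^ (-((N : ℝ) + 2 * s)))
        (ball x₀ R)ᶜ := by
      refine ((hint t htI).const_mul (2 ^ (N + 2))).mono' ?_ ?_
      · exact ((hgm t).mul (Measurable.pow_const (by fun_prop) _)).aestronglyMeasurable
      · rw [ae_restrict_iff' measurableSet_ball.compl]
        refine Filter.Eventually.of_forall fun y hy => ?_
        rw [Real.norm_of_nonneg (mul_nonneg (hg0 y t) (by positivity))]
        exact hle2 y hy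
    refine ⟨?_, ?_⟩
    · rw [← integrableOn_iff_integrable_of_support_subset (s := (ball x₀ R)ᶜ)]
      · exact hi
      · intro y hy
        by_contra h
        exact hy (hz y h)
    · rw [← setIntegral_eq_integral_of_forall_compl_eq_zero hz]
      calc _ ≤ ∫ y in (ball x₀ R)ᶜ, 2 ^ (N + 2) *
            (|uminus N u y t| * ‖y - x₀‖ ^ (-((N : ℝ) + 2 * s))) :=
            setIntegral_mono_on hi ((hint t htI).const_mul _) measurableSet_ball.compl hle2
        _ = 2 ^ (N + 2) * f t := by rw [integral_const_mul]
        _ ≤ 2 ^ (N + 2) * essSup f (volume.restrict (Ioo t₀ (t₀ + r ^ 2))) := by gcongr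
        _ = _ := by
            rw [htl]
            field_simp

theorem aux_dt_zero {N : ℕ} {φ : E N → ℝ → ℝ} {ψ : E N → ℝ} {η : ℝ → ℝ}
    (h1 : ∀ x t, x ∉ tsupport ψ → φ x t = 0) (h2 : ∀ x t, t ∉ tsupport η → φ x t = 0) :
    (∀ x t, x ∉ tsupport ψ → deriv (fun τ => φ x τ) t = 0) ∧
    (∀ x t, t ∉ tsupport η → deriv (fun τ => φ x τ) t = 0) := by
  constructor
  · intro x t hx
    have : (fun τ => φ x τ) = fun _ => 0 := funext fun τ => h1 x τ hx
    rw [this]; simp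
  · intro x t ht
    have : (fun τ => φ x τ) =ᶠ[nhds t] fun _ => 0 := by
      filter_upwards [(isClosed_tsupport η).isOpen_compl.mem_nhds ht] with τ hτ
      exact h2 x τ hτ
    rw [this.deriv_eq]; simp

theorem aux_time_const {N : ℕ} {φ W : E N → ℝ → ℝ} {ψ : E N → ℝ} {η : ℝ → ℝ}
    (hφ : ContDiff ℝ (⊤ : ℕ∞) (fun z : E N × ℝ => φ z.1 z.2))
    (hW : Continuous (fun z : E N × ℝ => W z.1 z.2))
    (hψ : HasCompactSupport ψ) (hη : HasCompactSupport η)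
    (h1 : ∀ x t, x ∉ tsupport ψ → φ x t = 0) (h2 : ∀ x t, t ∉ tsupport η → φ x t = 0) (l : ℝ) :
    ∫ t, ∫ x, (W x t - l) * deriv (fun τ => φ x τ) t =
      ∫ t, ∫ x, W x t * deriv (fun τ => φ x τ) t := by
  obtain ⟨z1, z2⟩ := aux_dt_zero h1 h2
  have hc := aux_Wt hφ
  have I1 : Integrable (fun z : E N × ℝ => W z.1 z.2 * deriv (fun τ => φ z.1 τ) z.2)
      (volume.prod volume) :=
    aux_int_prod (f := fun x t => W x t * deriv (fun τ => φ x τ) t) (hW.mul hc) hψ hη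
      (fun x t hx => by rw [z1 x t hx, mul_zero]) (fun x t hx => by rw [z2 x t hx, mul_zero])
  have I2 : Integrable (fun z : E N × ℝ => deriv (fun τ => φ z.1 τ) z.2)
      (volume.prod volume) :=
    aux_int_prod (f := fun x t => deriv (fun τ => φ x τ) t) hc hψ hη z1 z2
  have Z : ∫ t, ∫ x, deriv (fun τ => φ x τ) t = 0 := by
    have e := integral_prod_symm _ I2
    rw [integral_prod _ I2] at e
    rw [← e]
    have : ∀ x, ∫ t, deriv (fun τ => φ x τ) t = 0 := by
      intro x
      have hs : ContDiff ℝ (⊤ : ℕ∞) (fun τ => φ x τ) :=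
        hφ.comp (f := fun τ : ℝ => (x, τ)) (by fun_prop)
      apply integral_eq_zero_of_hasDerivAt_of_integrable (f := fun τ => φ x τ)
      · intro t
        exact (aux_sliceT hφ x t).hasDerivAt
      · exact (hs.continuous_deriv (by simp)).integrable_of_hasCompactSupport
          (HasCompactSupport.intro hη.isCompact (fun t ht => z2 x t ht))
      · exact hs.continuous.integrable_of_hasCompactSupport
          (HasCompactSupport.intro hη.isCompact (fun t ht => h2 x t ht))
    simp only [this, integral_zero]
  have e1 : ∀ᵐ t : ℝ, ∫ x, (W x t - l) * deriv (fun τ => φ x τ) t =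
      (∫ x, W x t * deriv (fun τ => φ x τ) t) - l * ∫ x, deriv (fun τ => φ x τ) t := by
    filter_upwards [I1.prod_left_ae, I2.prod_left_ae] with t a1 a2
    rw [← integral_const_mul, ← integral_sub a1 (a2.const_mul _)]
    congr 1; ext x; ring
  rw [integral_congr_ae e1, integral_sub I1.integral_prod_right (I2.integral_prod_right.const_mul _),
    integral_const_mul, Z, mul_zero, sub_zero]

/-- replace set integrals by full ones -/
theorem aux_setfull {N : ℕ} {f : E N → ℝ → ℝ} {Ω : Set (E N)} {I : Set ℝ}
    (h1 : ∀ x t, x ∉ Ω → f x t = 0) (h2 : ∀ x t, t ∉ I → f x t = 0) :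
    ∫ t in I, ∫ x in Ω, f x t = ∫ t, ∫ x, f x t := by
  rw [setIntegral_eq_integral_of_forall_compl_eq_zero]
  · congr 1
    ext t
    exact setIntegral_eq_integral_of_forall_compl_eq_zero (fun x hx => h1 x t hx)
  · intro t ht
    simp only [h2 _ t ht, integral_zero]

def CE (N : ℕ) (s Λ p L r : ℝ) : ℝ :=
  4 / (1 - p) * L ^ 2 + 2 * Λ * ((1 - p)⁻¹ * L ^ 2 * CK N s + 2 ^ (N + 2) / r ^ 2)

theorem aux_energy (N : ℕ) (hN : 2 ≤ N) (s : ℝ) (hs : s ∈ Set.Ioo (0 : ℝ) 1) {Λ T : ℝ}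
    (hΛ : 1 ≤ Λ) {Ω : Set (E N)} {K : E N → E N → ℝ → ℝ} {u : E N → ℝ → ℝ}
    {x₀ : E N} {R r t₀ l : ℝ} (hK : KernelOK N s Λ T K) (hu : IsWeakSupersolution N T K Ω u)
    (hBR : ball x₀ R ⊆ Ω) (hI : Ioo t₀ (t₀ + r ^ 2) ⊆ Ioo 0 T)
    (hu0 : ∀ x ∈ Metric.ball x₀ R, ∀ t ∈ Set.Ioo t₀ (t₀ + r ^ 2), 0 ≤ u x t)
    (hr : 0 < r) (hrR : r < R / 2) (hl : 0 < l)
    (htail : (r / R) ^ 2 * tailInfty N s (uminus N u) x₀ R t₀ (t₀ + r ^ 2) ≤ l)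
    {p : ℝ} (hp0 : 0 < p) (hp1 : p < 1) {W : E N → ℝ → ℝ}
    (hW : ContDiff ℝ (⊤ : ℕ∞) (fun z : E N × ℝ => W z.1 z.2)) (hpos : ∀ x t, 0 < W x t)
    {τ0 τ2 : ℝ} (hτ : Ioo τ0 τ2 ⊆ Ioo t₀ (t₀ + r ^ 2))
    (hWu : ∀ x ∈ ball x₀ (R / 2), ∀ t ∈ Ioo τ0 τ2, W x t = u x t + l)
    {a L : ℝ} (ha : a ≤ r) (hL : 1 ≤ L) {ψ : E N → ℝ} (hψ : ContDiff ℝ (⊤ : ℕ∞) ψ)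
    (hψ0 : ∀ x, 0 ≤ ψ x) (hψ1 : ∀ x, ψ x ≤ 1) (hψB : ∀ x, x ∉ ball x₀ a → ψ x = 0)
    (hψL : ∀ x y, |ψ x - ψ y| ≤ L * ‖x - y‖) (hψD : ∀ x, ‖fderiv ℝ ψ x‖ ≤ L)
    {η : ℝ → ℝ} (hη : ContDiff ℝ (⊤ : ℕ∞) η) (hη0 : ∀ t, 0 ≤ η t) (hηs : tsupport η ⊆ Ioo τ0 τ2) :
    (∫ t, deriv η t * ∫ x, ψ x ^ 2 * W x t ^ p) +
      (1 - p) * (∫ t, η t * ∫ x, ‖fderiv ℝ (fun y => ψ y * W y t ^ (p / 2)) x‖ ^ 2) ≤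
      CE N s Λ p L r * ∫ t, η t * ∫ x in closedBall x₀ a, W x t ^ p := by
  obtain ⟨hum, ⟨M₀, hub⟩, hus, hweak⟩ := hu
  obtain ⟨hKm, hKs, hKb⟩ := hK
  have hR : 0 < R := by linarith
  have hq : 0 < 1 - p := by linarith
  have hψt : tsupport ψ ⊆ closedBall x₀ a := by
    apply closure_minimal _ isClosed_closedBall
    intro x hx
    by_contra h
    exact hx (hψB x (fun h' => h (ball_subset_closedBall h')))
  have hcb : closedBall x₀ a ⊆ ball x₀ (R / 2) := closedBall_subset_ball (by linarith)
  have hcbΩ : closedBall x₀ a ⊆ Ω := (hcb.trans (ball_subset_ball (by linarith))).trans hBR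
  have hψc : HasCompactSupport ψ :=
    (isCompact_closedBall x₀ a).of_isClosed_subset (isClosed_tsupport _) hψt
  have hηc : HasCompactSupport η :=
    (isCompact_Icc (a := τ0) (b := τ2)).of_isClosed_subset (isClosed_tsupport _)
      (hηs.trans Ioo_subset_Icc_self)
  have hη00 : ∀ t, t ∉ tsupport η → η t = 0 := fun t ht => image_eq_zero_of_notMem_tsupport ht
  have hψ00 : ∀ x, x ∉ tsupport ψ → ψ x = 0 := fun t ht => image_eq_zero_of_notMem_tsupport ht
  set φ : E N → ℝ → ℝ := fun x t => η t * (ψ x ^ 2 * W x t ^ (p - 1)) with hφd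
  have hφ : ContDiff ℝ (⊤ : ℕ∞) (fun z : E N × ℝ => φ z.1 z.2) :=
    (hη.comp contDiff_snd).mul (((hψ.comp contDiff_fst).pow 2).mul (aux_rpow_smooth hW hpos _))
  have f1 : ∀ x t, x ∉ tsupport ψ → φ x t = 0 := by
    intro x t hx; simp [hφd, hψ00 x hx]
  have f2 : ∀ x t, t ∉ tsupport η → φ x t = 0 := by
    intro x t hx; simp [hφd, hη00 t hx]
  have hφt : tsupport (fun z : E N × ℝ => φ z.1 z.2) ⊆ closedBall x₀ a ×ˢ tsupport η := by
    apply closure_minimal _ (isClosed_closedBall.prod (isClosed_tsupport η))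
    intro z hz
    by_contra h
    rw [mem_prod, not_and_or] at h
    rcases h with h | h
    · exact hz (f1 _ _ (fun h' => h (hψt h')))
    · exact hz (f2 _ _ h)
  have hweak := hweak φ hφ
    (((isCompact_closedBall x₀ a).prod hηc).of_isClosed_subset (isClosed_tsupport _) hφt)
    (hφt.trans (prod_mono hcbΩ ((hηs.trans hτ).trans hI)))
    (fun x t => mul_nonneg (hη0 t) (mul_nonneg (sq_nonneg _) (Real.rpow_nonneg (hpos x t).le _)))
  obtain ⟨z1, z2⟩ := aux_dt_zero f1 f2
  -- time term
  have T1 : (∫ t in Set.Ioo 0 T, ∫ x in Ω, u x t * deriv (fun τ => φ x τ) t) =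
      p⁻¹ * ∫ t, deriv η t * ∫ x, ψ x ^ 2 * W x t ^ p := by
    rw [aux_setfull (f := fun x t => u x t * deriv (fun τ => φ x τ) t)
      (fun x t hx => by
        rw [z1 x t (fun h => hx (hcbΩ (hψt h))), mul_zero])
      (fun x t ht => by
        rw [z2 x t (fun h => ht (hI (hτ (hηs h)))), mul_zero])]
    rw [← aux_time hp0 hW hpos hψ hη hψc hηc,
      ← aux_time_const (φ := φ) (l := l) hφ hW.continuous hψc hηc f1 f2]
    congr 1; ext t; congr 1; ext x
    by_cases hx : x ∈ tsupport ψ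
    · by_cases ht : t ∈ tsupport η
      · rw [hWu x (hcb (hψt hx)) t (hηs ht)]; ring
      · rw [z2 x t ht]; ring
    · rw [z1 x t hx]; ring
  -- space term
  have hgz : ∀ x t, (x ∉ tsupport ψ ∨ t ∉ tsupport η) → gradient (fun y => φ y t) x = 0 := by
    intro x t h
    have : (fun y => φ y t) =ᶠ[nhds x] fun _ => 0 := by
      rcases h with h | h
      · filter_upwards [(isClosed_tsupport ψ).isOpen_compl.mem_nhds h] with y hy
        exact f1 y t hy
      · exact Filter.Eventually.of_forall fun y => f2 y t h
    rw [gradient, this.fderiv_eq]; simp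
  have T2 : (∫ t in Set.Ioo 0 T, ∫ x in Ω,
      ⟪gradient (fun y => u y t) x, gradient (fun y => φ y t) x⟫) =
      ∫ t, ∫ x, ⟪gradient (fun y => W y t) x, gradient (fun y => φ y t) x⟫ := by
    rw [aux_setfull (f := fun x t => ⟪gradient (fun y => u y t) x, gradient (fun y => φ y t) x⟫)
      (fun x t hx => by
        rw [hgz x t (Or.inl (fun h => hx (hcbΩ (hψt h)))), inner_zero_right])
      (fun x t ht => by
        rw [hgz x t (Or.inr (fun h => ht (hI (hτ (hηs h))))), inner_zero_right])]
    congr 1; ext t; congr 1; ext x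
    by_cases hx : x ∈ tsupport ψ
    · by_cases ht : t ∈ tsupport η
      · have : (fun y => u y t) =ᶠ[nhds x] fun y => W y t - l := by
          filter_upwards [isOpen_ball.mem_nhds (hcb (hψt hx))] with y hy
          rw [hWu y hy t (hηs ht)]; ring
        have : gradient (fun y => u y t) x = gradient (fun y => W y t) x := by
          rw [gradient, gradient, this.fderiv_eq, fderiv_sub_const]
        rw [this]
      · rw [hgz x t (Or.inr ht), inner_zero_right, inner_zero_right]
    · rw [hgz x t (Or.inl hx), inner_zero_right, inner_zero_right]
  set H : ℝ → ℝ := fun t => ∫ x in closedBall x₀ a, W x t ^ p with hHd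
  have hWp := (aux_rpow_smooth hW hpos p).continuous
  have hHc : Continuous H := by
    apply continuous_parametric_integral_of_continuous _ (isCompact_closedBall x₀ a)
    exact hWp.comp (continuous_snd.prodMk continuous_fst)
  have hH0 : ∀ t, 0 ≤ H t := fun t => integral_nonneg fun x => Real.rpow_nonneg (hpos x t).le _
  have hηH : Integrable (fun t => η t * H t) :=
    (hη.continuous.mul hHc).integrable_of_hasCompactSupport
      (HasCompactSupport.intro hηc.isCompact (fun t ht => by rw [Pi.mul_apply, hη00 t ht, zero_mul]))
  have hIW : ∀ t, IntegrableOn (fun x => W x t ^ p) (closedBall x₀ a) := fun t =>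
    (hWp.comp (continuous_id.prodMk continuous_const : Continuous fun x : E N => (x, t))).continuousOn.integrableOn_compact
      (isCompact_closedBall x₀ a)
  -- nonlocal term
  set D := 2 * Λ * ((1 - p)⁻¹ * L ^ 2 * CK N s + 2 ^ (N + 2) / r ^ 2) with hD
  have hCK := CK_nonneg N s
  have hD0 : 0 ≤ D := by positivity
  have T3 : (∫ t in Set.Ioo 0 T, ∫ x : E N, ∫ y : E N,
      (u x t - u y t) * (φ x t - φ y t) * K x y t) ≤ D * ∫ t, η t * H t := by
    have e : D * ∫ t, η t * H t = ∫ t in Set.Ioo 0 T, D * (η t * H t) := by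
      rw [setIntegral_eq_integral_of_forall_compl_eq_zero, integral_const_mul]
      intro t ht
      rw [hη00 t (fun h => ht (hI (hτ (hηs h))))]; simp
    rw [e]
    apply aux_integral_le
    · apply ae_restrict_of_ae
      filter_upwards [(aux_tail N hN s hs hum hub hI hu0 hr hrR).2] with t ht
      by_cases htη : t ∈ tsupport η
      · have htτ := hηs htη
        have htI := hτ htτ
        have ht := ht htI
        have := aux_NL N hN s hs (Λ := Λ) (p := p) (L := L) (M := 2 ^ (N + 2) / r ^ 2) (c := η t)
          (l := l) (Mw := M₀ + l) (by linarith) hp0 hp1 hL (by positivity) (hη0 t)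
          (k := fun x y => K x y t) (fun x y hxy => le_trans (by positivity) (hKb x y hxy t (hI htI)).1)
          (fun x y hxy => (hKb x y hxy t (hI htI)).2) (B := ball x₀ a) measurableSet_ball
          measure_ball_lt_top (w := fun x => u x t + l) (g := fun x => uminus N u x t) (ψ := ψ)
          ((hum.comp (measurable_id.prodMk measurable_const :
            Measurable fun y : E N => (y, t))).add_const l)
          ((hum.comp (measurable_id.prodMk measurable_const :
            Measurable fun y : E N => (y, t))).neg.max measurable_const)
          hψ.continuous.measurable hl
          (fun x hx => by
            have := hu0 x (ball_subset_ball (by linarith) hx) t htI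
            linarith)
          (fun x hx => by
            have := (le_abs_self _).trans (hub x t (hI htI))
            linarith)
          (fun y => le_max_right _ _)
          (fun y => by
            have : -(u y t) ≤ uminus N u y t := le_max_left _ _
            linarith)
          hψL hψ0 hψ1 hψB
          (fun x hx => (ht x (ball_subset_ball ha hx)).1)
          (fun x hx => by
            refine (ht x (ball_subset_ball ha hx)).2.trans ?_
            have := hu0 x (ball_subset_ball (by linarith) hx) t htI
            gcongr
            linarith)
        have hφe : ∀ x, φ x t = η t * (ψ x ^ 2 * (u x t + l) ^ (p - 1)) := by
          intro x
          by_cases hx : x ∈ tsupport ψ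
          · simp only [hφd]
            rw [hWu x (hcb (hψt hx)) t htτ]
          · rw [f1 x t hx, hψ00 x hx]; simp
        have e2 : (∫ x in ball x₀ a, (u x t + l) ^ p) ≤ H t := by
          have : (∫ x in ball x₀ a, (u x t + l) ^ p) = ∫ x in ball x₀ a, W x t ^ p :=
            setIntegral_congr_fun measurableSet_ball (fun x hx => by
              rw [hWu x (hcb (ball_subset_closedBall hx)) t htτ])
          rw [this]
          exact setIntegral_mono_set (hIW t)
            (Filter.Eventually.of_forall fun x => Real.rpow_nonneg (hpos x t).le _)
            ball_subset_closedBall.eventuallyLE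
        calc _ = ∫ x, ∫ y, (u x t + l - (u y t + l)) * (η t * (ψ x ^ 2 * (u x t + l) ^ (p - 1)) -
              η t * (ψ y ^ 2 * (u y t + l) ^ (p - 1))) * K x y t := by
              simp only [hφe, add_sub_add_right_eq_sub]
          _ ≤ _ := this
          _ ≤ η t * D * H t := by
              gcongr
              exact mul_nonneg (hη0 t) hD0
          _ = _ := by ring
      · simp only [f2 _ t htη, hη00 t htη]
        simp
    · exact Filter.Eventually.of_forall fun t => mul_nonneg hD0 (mul_nonneg (hη0 t) (hH0 t))
    · exact (hηH.const_mul D).integrableOn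
  obtain ⟨S1, -, -⟩ := aux_space hp0 hp1 hW hpos hψ hη.continuous hη0 hψc hηc
  have S2 : (∫ t, η t * ∫ x, W x t ^ p * ‖fderiv ℝ ψ x‖ ^ 2) ≤ L ^ 2 * ∫ t, η t * H t := by
    rw [← integral_const_mul]
    apply aux_integral_le
    · refine Filter.Eventually.of_forall fun t => ?_
      have : (∫ x, W x t ^ p * ‖fderiv ℝ ψ x‖ ^ 2) ≤ L ^ 2 * H t := by
        rw [← setIntegral_eq_integral_of_forall_compl_eq_zero (s := closedBall x₀ a), hHd,
          ← integral_const_mul]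
        · apply aux_integral_le
          · refine Filter.Eventually.of_forall fun x => ?_
            dsimp only
            rw [mul_comm]
            gcongr
            · exact Real.rpow_nonneg (hpos x t).le _
            · exact hψD x
          · exact Filter.Eventually.of_forall fun x =>
              mul_nonneg (sq_nonneg _) (Real.rpow_nonneg (hpos x t).le _)
          · exact (hIW t).const_mul _
        · intro x hx
          have hx' : x ∉ tsupport ψ := fun h => hx (hψt h)
          have : fderiv ℝ ψ x = 0 := by
            by_contra h
            exact hx' (support_fderiv_subset ℝ h)
          rw [this]; simp
      calc _ ≤ η t * (L ^ 2 * H t) := mul_le_mul_of_nonneg_left this (hη0 t)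
        _ = _ := by ring
    · exact Filter.Eventually.of_forall fun t => mul_nonneg (sq_nonneg _) (mul_nonneg (hη0 t) (hH0 t))
    · exact hηH.const_mul _
  rw [T1, T2] at hweak
  have hHH : 0 ≤ ∫ t, η t * H t := integral_nonneg fun t => mul_nonneg (hη0 t) (hH0 t)
  have hw2 := mul_le_mul_of_nonneg_left hweak hp0.le
  rw [mul_zero, mul_add, mul_add, mul_neg, ← mul_assoc, mul_inv_cancel₀ hp0.ne', one_mul] at hw2
  have h3 := mul_le_mul_of_nonneg_left T3 hp0.le
  have h4 : p * (D * ∫ t, η t * H t) ≤ D * ∫ t, η t * H t := by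
    have := mul_nonneg hD0 hHH
    nlinarith
  have h5 := mul_le_mul_of_nonneg_left S2 (by positivity : 0 ≤ 4 / (1 - p))
  have h6 : CE N s Λ p L r = 4 / (1 - p) * L ^ 2 + D := rfl
  rw [h6]
  have h7 : (4 / (1 - p) * L ^ 2 + D) * (∫ t, η t * H t) =
    4 / (1 - p) * (L ^ 2 * ∫ t, η t * H t) + D * ∫ t, η t * H t := by ring
  rw [h7]
  linarith

theorem aux_wint {N : ℕ} {u : E N → ℝ → ℝ} {x₀ : E N} {R r t₀ l T M₀ a α : ℝ}
    (hum : Measurable (fun p : E N × ℝ => u p.1 p.2))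
    (hub : ∀ x t, t ∈ Set.Ioo 0 T → |u x t| ≤ M₀) (hI : Set.Ioo t₀ (t₀ + r ^ 2) ⊆ Set.Ioo 0 T)
    (hu0 : ∀ x ∈ Metric.ball x₀ R, ∀ t ∈ Set.Ioo t₀ (t₀ + r ^ 2), 0 ≤ u x t)
    (hrR : r < R / 2) (hl : 0 < l) (ha0 : 0 < a) (ha : a ≤ r) (hα : 0 ≤ α) :
    IntegrableOn (fun z : E N × ℝ => (u z.1 z.2 + l) ^ α) (ball x₀ a ×ˢ Ioo t₀ (t₀ + a ^ 2)) ∧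
    IntegrableOn (fun t => ∫ x in ball x₀ a, (u x t + l) ^ α) (Ioo t₀ (t₀ + a ^ 2)) ∧
    (∫ z in ball x₀ a ×ˢ Ioo t₀ (t₀ + a ^ 2), (u z.1 z.2 + l) ^ α) =
      ∫ t in Ioo t₀ (t₀ + a ^ 2), ∫ x in ball x₀ a, (u x t + l) ^ α := by
  have hsub : Ioo t₀ (t₀ + a ^ 2) ⊆ Ioo t₀ (t₀ + r ^ 2) := by
    apply Ioo_subset_Ioo le_rfl
    have : a ^ 2 ≤ r ^ 2 := by gcongr
    linarith
  have hfin : volume (ball x₀ a ×ˢ Ioo t₀ (t₀ + a ^ 2)) < ⊤ := by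
    rw [Measure.volume_eq_prod, Measure.prod_prod]
    exact ENNReal.mul_lt_top measure_ball_lt_top measure_Ioo_lt_top
  have h1 : IntegrableOn (fun z : E N × ℝ => (u z.1 z.2 + l) ^ α)
      (ball x₀ a ×ˢ Ioo t₀ (t₀ + a ^ 2)) := by
    refine Measure.integrableOn_of_bounded (M := (M₀ + l) ^ α) hfin.ne ?_ ?_
    · exact ((hum.add_const l).pow_const α).aestronglyMeasurable
    · rw [ae_restrict_iff' (measurableSet_ball.prod measurableSet_Ioo)]
      refine Filter.Eventually.of_forall fun z hz => ?_
      have hz2 := hsub hz.2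
      have h0 := hu0 z.1 (ball_subset_ball (by linarith) hz.1) z.2 hz2
      have h2 := (le_abs_self _).trans (hub z.1 z.2 (hI hz2))
      rw [Real.norm_of_nonneg (by positivity)]
      gcongr
  have h1' : Integrable (fun z : E N × ℝ => (u z.1 z.2 + l) ^ α)
      ((volume.restrict (ball x₀ a)).prod (volume.restrict (Ioo t₀ (t₀ + a ^ 2)))) := by
    rw [Measure.prod_restrict]; exact h1
  refine ⟨h1, h1'.integral_prod_right, ?_⟩
  rw [Measure.volume_eq_prod, ← Measure.prod_restrict]
  exact integral_prod_symm _ h1'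

theorem aux_gamma (N : ℕ) (hN : 2 ≤ N) : 1 < 2 - 2 / kappa N ∧ 2 - 2 / kappa N < 2 ∧
    0 ≤ 2 * N / kappa N - N + 2 := by
  obtain ⟨h1, h2, h3⟩ := kappa_facts N hN
  have hk : 0 < kappa N := by linarith
  have hN0 : (0 : ℝ) < N := by exact_mod_cast (by omega : 0 < N)
  have h4 : 2 / kappa N < 1 := by rw [div_lt_one hk]; exact h1
  refine ⟨by linarith, by linarith [div_pos two_pos hk], ?_⟩
  have : 2 * N / kappa N - N + 2 = 2 * N * ((kappa N)⁻¹ + (N : ℝ)⁻¹ - 1 / 2) := by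
    field_simp
    ring
  rw [this]
  apply mul_nonneg (by positivity)
  linarith

theorem aux_parcont {N : ℕ} {x₀ : E N} {a : ℝ} {g : E N → ℝ → ℝ}
    (hg : Continuous fun z : E N × ℝ => g z.1 z.2) (hz : ∀ x t, x ∉ closedBall x₀ a → g x t = 0) :
    Continuous fun t => ∫ x, g x t := by
  have h : (fun t => ∫ x, g x t) = fun t => ∫ x in closedBall x₀ a, g x t := by
    funext t
    rw [setIntegral_eq_integral_of_forall_compl_eq_zero]
    intro x hx
    exact hz x t hx
  rw [h]
  have hsw : Continuous (fun z : ℝ × E N => (z.2, z.1)) := continuous_snd.prodMk continuous_fst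
  have := continuous_parametric_integral_of_continuous (μ := (volume : Measure (E N)))
    (f := fun t x => g x t) (hg.comp hsw) (isCompact_closedBall x₀ a)
  exact this

set_option maxHeartbeats 1600000 in
theorem aux_step1 (N : ℕ) (hN : 2 ≤ N) (s : ℝ) (hs : s ∈ Set.Ioo (0 : ℝ) 1) {Λ T : ℝ}
    (hΛ : 1 ≤ Λ) {Ω : Set (E N)} {K : E N → E N → ℝ → ℝ} {u : E N → ℝ → ℝ}
    {x₀ : E N} {R r t₀ l : ℝ} (hK : KernelOK N s Λ T K) (hu : IsWeakSupersolution N T K Ω u)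
    (hBR : ball x₀ R ⊆ Ω) (hI : Ioo t₀ (t₀ + r ^ 2) ⊆ Ioo 0 T)
    (hu0 : ∀ x ∈ Metric.ball x₀ R, ∀ t ∈ Set.Ioo t₀ (t₀ + r ^ 2), 0 ≤ u x t)
    (hr : 0 < r) (hr1 : r ≤ 1) (hrR : r < R / 2) (hl : 0 < l)
    (htail : (r / R) ^ 2 * tailInfty N s (uminus N u) x₀ R t₀ (t₀ + r ^ 2) ≤ l)
    {CS : ℝ} (hCS0 : 0 < CS) (hCS : ∀ (a : ℝ), 0 < a → ∀ (x₀ : E N)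
      (v : E N → ℝ), ContDiff ℝ 1 v → (∀ x, 0 ≤ v x) → (∀ x, x ∉ ball x₀ a → v x = 0) →
      ∫ x, v x ^ (2 * (2 - 2 / kappa N)) ≤
      CS * a ^ (2 * N / kappa N - N + 2) * (∫ x, ‖fderiv ℝ v x‖ ^ 2) *
        (∫ x, v x ^ 2) ^ (1 - 2 / kappa N))
    {p : ℝ} (hp0 : 0 < p) (hp1 : p < 1) {a b : ℝ} (hb : 0 < b) (hba : b < a) (ha : a ≤ r) :
    ∫ t in Ioo t₀ (t₀ + b ^ 2), ∫ x in ball x₀ b, (u x t + l) ^ (p * (2 - 2 / kappa N)) ≤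
      CS * a ^ (2 * N / kappa N - N + 2) * (1 - p)⁻¹ *
        ((CE N s Λ p (cST / (a - b)) r + cST / ((a ^ 2 - b ^ 2) / 2)) *
          ∫ t in Ioo t₀ (t₀ + a ^ 2), ∫ x in ball x₀ a, (u x t + l) ^ p) ^ (2 - 2 / kappa N) := by
  obtain ⟨hum, ⟨M₀, hub⟩, hus, hweak⟩ := id hu
  obtain ⟨hγ1, hγ2, he⟩ := aux_gamma N hN
  set γ := 2 - 2 / kappa N with hγ
  set e := 2 * N / kappa N - N + 2 with hed
  have hγe : 1 - 2 / kappa N = γ - 1 := by rw [hγ]; ring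
  rw [hγe] at hCS
  have ha0 : 0 < a := hb.trans hba
  have hq : 0 < 1 - p := by linarith
  have hR : 0 < R := by linarith
  have hsq : b ^ 2 < a ^ 2 := by gcongr
  have hsq2 : a ^ 2 ≤ r ^ 2 := by gcongr
  have hb2 : 0 < b ^ 2 := by positivity
  set L := cST / (a - b) with hL
  have hL1 : 1 ≤ L := by
    rw [hL, le_div_iff₀ (by linarith)]
    linarith [cST_one]
  set CA := CE N s Λ p L r + cST / ((a ^ 2 - b ^ 2) / 2) with hCA
  have hCE0 : 0 ≤ CE N s Λ p L r := by
    have := CK_nonneg N s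
    unfold CE; positivity
  have hc0 : 0 ≤ cST := by linarith [cST_one]
  have hCA0 : 0 ≤ CA := by
    have : 0 < (a ^ 2 - b ^ 2) / 2 := by linarith
    positivity
  set J := ∫ t in Ioo t₀ (t₀ + a ^ 2), ∫ x in ball x₀ a, (u x t + l) ^ p with hJ
  obtain ⟨-, hJi, -⟩ := aux_wint (α := p) hum hub hI hu0 hrR hl ha0 ha hp0.le
  obtain ⟨-, hJi', -⟩ := aux_wint (α := p * γ) hum hub hI hu0 hrR hl hb (hba.le.trans ha)
    (by positivity)
  have hwpos : ∀ x ∈ ball x₀ R, ∀ t ∈ Ioo t₀ (t₀ + r ^ 2), 0 < u x t + l := by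
    intro x hx t ht
    linarith [hu0 x hx t ht]
  obtain ⟨ψ, hψ, hψ0, hψ1, hψb, hψB, hψL, hψD⟩ := aux_cutoff x₀ hb hba
  set τ1 := t₀ + b ^ 2 with hτ1
  set τm := t₀ + (a ^ 2 + b ^ 2) / 2 with hτm
  set τ2 := (τm + (t₀ + a ^ 2)) / 2 with hτ2
  have hm1 : τ1 < τm := by rw [hτ1, hτm]; linarith
  have hm2 : τm < τ2 := by rw [hτ2, hτm]; linarith
  have hm3 : τ2 < t₀ + a ^ 2 := by rw [hτ2, hτm]; linarith
  have main : ∀ τ, t₀ < τ → τ < τ1 → ∫ t in Ioo τ τ1, ∫ x in ball x₀ b, (u x t + l) ^ (p * γ) ≤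
      CS * a ^ e * (1 - p)⁻¹ * (CA * J) ^ γ := by
    intro τ h1 h2
    set τ0 := (t₀ + τ) / 2 with hτ0
    have h3 : t₀ < τ0 := by rw [hτ0]; linarith
    have h4 : τ0 < τ := by rw [hτ0]; linarith
    obtain ⟨W, hW, hpos, hWu⟩ := aux_ext (x₀ := x₀) (u := u) hR hl h3 (τ2 := τ2) (by linarith)
      (tb := t₀ + r ^ 2) (by linarith) (hus.mono (prod_mono hBR hI)) hu0
    have hτs : Ioo τ0 τ2 ⊆ Ioo t₀ (t₀ + a ^ 2) := Ioo_subset_Ioo h3.le hm3.le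
    have hτs' : Ioo τ0 τ2 ⊆ Ioo t₀ (t₀ + r ^ 2) := Ioo_subset_Ioo h3.le (by linarith)
    have hWp := (aux_rpow_smooth hW hpos p).continuous
    have hψz : ∀ x, x ∉ closedBall x₀ a → ψ x = 0 := fun x hx =>
      hψB x (fun h => hx (ball_subset_closedBall h))
    have hψt : tsupport ψ ⊆ closedBall x₀ a := by
      apply closure_minimal _ isClosed_closedBall
      intro x hx
      by_contra h
      exact hx (hψz x h)
    have hψc : HasCompactSupport ψ :=
      (isCompact_closedBall x₀ a).of_isClosed_subset (isClosed_tsupport _) hψt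
    set F : ℝ → ℝ := fun t => ∫ x, ψ x ^ 2 * W x t ^ p with hF
    set G : ℝ → ℝ := fun t => ∫ x, ‖fderiv ℝ (fun y => ψ y * W y t ^ (p / 2)) x‖ ^ 2 with hG
    set H : ℝ → ℝ := fun t => ∫ x in closedBall x₀ a, W x t ^ p with hH
    have hsw : Continuous (fun z : ℝ × E N => (z.2, z.1)) := continuous_snd.prodMk continuous_fst
    have hHc : Continuous H := by
      apply continuous_parametric_integral_of_continuous _ (isCompact_closedBall x₀ a)
      exact hWp.comp hsw
    have hFe : ∀ t, F t = ∫ x in closedBall x₀ a, ψ x ^ 2 * W x t ^ p := by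
      intro t
      rw [setIntegral_eq_integral_of_forall_compl_eq_zero]
      intro x hx
      rw [hψz x hx]; ring
    have hFi : Continuous (fun z : E N × ℝ => ψ z.1 ^ 2 * W z.1 z.2 ^ p) :=
      ((hψ.continuous.comp continuous_fst).pow 2).mul hWp
    have hFc : Continuous F := by
      rw [funext hFe]
      apply continuous_parametric_integral_of_continuous _ (isCompact_closedBall x₀ a)
      exact hFi.comp hsw
    obtain ⟨-, hGi, hGz⟩ := aux_space (η := fun _ => 0) hp0 hp1 hW hpos hψ continuous_const
      (fun _ => le_rfl) hψc HasCompactSupport.zero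
    have hGc : Continuous G :=
      aux_parcont (x₀ := x₀) (a := a)
        (g := fun x t => ‖fderiv ℝ (fun y => ψ y * W y t ^ (p / 2)) x‖ ^ 2) hGi
        (fun x t hx => hGz x t (fun h => hx (hψt h)))
    have hslice : ∀ t : ℝ, Continuous fun x : E N => (x, t) := fun t =>
      continuous_id.prodMk continuous_const
    have hF0 : ∀ t, 0 ≤ F t := fun t => integral_nonneg fun x =>
      mul_nonneg (sq_nonneg _) (Real.rpow_nonneg (hpos x t).le _)
    have hG0 : ∀ t, 0 ≤ G t := fun t => integral_nonneg fun x => sq_nonneg _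
    have hFH : ∀ t, F t ≤ H t := by
      intro t
      rw [hFe]
      apply integral_mono
      · exact (hFi.comp (hslice t)).continuousOn.integrableOn_compact (isCompact_closedBall x₀ a)
      · exact (hWp.comp (hslice t)).continuousOn.integrableOn_compact (isCompact_closedBall x₀ a)
      · intro x
        have : ψ x ^ 2 ≤ 1 := pow_le_one₀ (hψ0 x) (hψ1 x)
        have h := Real.rpow_nonneg (hpos x t).le p
        show ψ x ^ 2 * W x t ^ p ≤ W x t ^ p
        nlinarith
    obtain ⟨o1, o2⟩ := aux_ode hFc hGc hHc hF0 hG0 hFH hp1 hCE0 h4 h2.le hm1 hm2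
      (fun η hη hη0 hηs => aux_energy N hN s hs hΛ hK hu hBR hI hu0 hr hrR hl htail hp0 hp1 hW hpos
        hτs' hWu ha hL1 hψ hψ0 hψ1 hψB hψL hψD hη hη0 hηs)
    have hmm : τm - τ1 = (a ^ 2 - b ^ 2) / 2 := by rw [hτm, hτ1]; ring
    rw [hmm, ← hCA] at o1 o2
    have hcb : ball x₀ a ⊆ ball x₀ (R / 2) := ball_subset_ball (by linarith)
    have hHJ : (∫ t in Ioo τ0 τ2, H t) ≤ J := by
      have : (∫ t in Ioo τ0 τ2, H t) = ∫ t in Ioo τ0 τ2, ∫ x in ball x₀ a, (u x t + l) ^ p := by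
        apply setIntegral_congr_fun measurableSet_Ioo
        intro t ht
        show (∫ x in closedBall x₀ a, W x t ^ p) = ∫ x in ball x₀ a, (u x t + l) ^ p
        have hae : (closedBall x₀ a : Set (E N)) =ᵐ[volume] ball x₀ a := by
          have : Nontrivial (E N) := by
            have : Nonempty (Fin N) := ⟨⟨0, by omega⟩⟩
            infer_instance
          exact
            (ae_eq_of_subset_of_measure_ge ball_subset_closedBall
              (Measure.addHaar_closedBall_eq_addHaar_ball volume x₀ a).le
              measurableSet_ball.nullMeasurableSet measure_closedBall_lt_top.ne).symm
        rw [setIntegral_congr_set hae]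
        apply setIntegral_congr_fun measurableSet_ball
        intro x hx
        show W x t ^ p = (u x t + l) ^ p
        rw [hWu x (hcb hx) t ht]
      rw [this]
      apply setIntegral_mono_set hJi _ hτs.eventuallyLE
      rw [Filter.EventuallyLE, ae_restrict_iff' measurableSet_Ioo]
      refine Filter.Eventually.of_forall fun t ht => ?_
      apply setIntegral_nonneg measurableSet_ball
      intro x hx
      apply Real.rpow_nonneg
      exact (hwpos x (ball_subset_ball (by linarith) hx) t (Ioo_subset_Ioo le_rfl (by linarith) ht)).le
    have hJA : CA * (∫ t in Ioo τ0 τ2, H t) ≤ CA * J := mul_le_mul_of_nonneg_left hHJ hCA0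
    have hA0 : 0 ≤ CA * J := by
      refine le_trans (mul_nonneg hCA0 ?_) hJA
      exact integral_nonneg fun t => (hF0 t).trans (hFH t)
    have hptw : ∀ t ∈ Ioo τ τ1, ∫ x in ball x₀ b, (u x t + l) ^ (p * γ) ≤
        CS * a ^ e * (CA * J) ^ (γ - 1) * G t := by
      intro t ht
      have htτ : t ∈ Ioo τ0 τ2 := ⟨h4.trans ht.1, by linarith [ht.2]⟩
      have hv : ContDiff ℝ 1 (fun x => ψ x * W x t ^ (p / 2)) :=
        (aux_sliceX (W := fun x t => ψ x * W x t ^ (p / 2)) (aux_v_smooth hW hpos hψ (p / 2)) t).of_le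
          (by exact_mod_cast le_top)
      have hS := hCS a ha0 x₀ _ hv
        (fun x => mul_nonneg (hψ0 x) (Real.rpow_nonneg (hpos x t).le _))
        (fun x hx => by rw [hψB x hx, zero_mul])
      have e1 : (∫ x, (ψ x * W x t ^ (p / 2)) ^ 2) = F t := by
        congr 1; ext x
        rw [mul_pow, ← Real.rpow_natCast (W x t ^ (p / 2)), ← Real.rpow_mul (hpos x t).le]
        congr 2; push_cast; ring
      rw [e1] at hS
      have e2 : (∫ x in ball x₀ b, (u x t + l) ^ (p * γ)) ≤
          ∫ x, (ψ x * W x t ^ (p / 2)) ^ (2 * γ) := by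
        have : (∫ x in ball x₀ b, (u x t + l) ^ (p * γ)) =
            ∫ x in ball x₀ b, (ψ x * W x t ^ (p / 2)) ^ (2 * γ) := by
          apply setIntegral_congr_fun measurableSet_ball
          intro x hx
          show (u x t + l) ^ (p * γ) = (ψ x * W x t ^ (p / 2)) ^ (2 * γ)
          rw [hψb x hx, one_mul, ← Real.rpow_mul (hpos x t).le,
            hWu x (hcb (ball_subset_ball hba.le hx)) t htτ]
          congr 1; ring
        rw [this]
        apply setIntegral_le_integral
        · apply Continuous.integrable_of_hasCompactSupport
          · exact hv.continuous.rpow_const (fun x => Or.inr (by positivity))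
          · refine HasCompactSupport.intro (isCompact_closedBall x₀ a) ?_
            intro x hx
            rw [hψz x hx, zero_mul, Real.zero_rpow (by positivity)]
        · exact Filter.Eventually.of_forall fun x => Real.rpow_nonneg
            (mul_nonneg (hψ0 x) (Real.rpow_nonneg (hpos x t).le _)) _
      refine e2.trans (hS.trans ?_)
      have h5 : F t ^ (γ - 1) ≤ (CA * J) ^ (γ - 1) :=
        Real.rpow_le_rpow (hF0 t) ((o1 t ⟨ht.1.le, ht.2⟩).trans hJA) (by linarith)
      calc _ = CS * a ^ e * G t * F t ^ (γ - 1) := rfl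
        _ ≤ CS * a ^ e * G t * (CA * J) ^ (γ - 1) := by
            have := hG0 t
            gcongr
        _ = _ := by ring
    have hGI : IntegrableOn G (Ioo τ τ1) :=
      (hGc.integrableOn_Icc (a := τ) (b := τ1)).mono_set Ioo_subset_Icc_self
    calc _ ≤ ∫ t in Ioo τ τ1, CS * a ^ e * (CA * J) ^ (γ - 1) * G t :=
          setIntegral_mono_on (hJi'.mono_set (Ioo_subset_Ioo h1.le le_rfl)) (hGI.const_mul _)
            measurableSet_Ioo hptw
      _ = CS * a ^ e * (CA * J) ^ (γ - 1) * ∫ t in Ioo τ τ1, G t := integral_const_mul _ _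
      _ ≤ CS * a ^ e * (CA * J) ^ (γ - 1) * ((1 - p)⁻¹ * (CA * J)) := by
          apply mul_le_mul_of_nonneg_left _ (by positivity)
          rw [inv_mul_eq_div, le_div_iff₀ hq]
          linarith
      _ = CS * a ^ e * (1 - p)⁻¹ * ((CA * J) ^ (γ - 1) * (CA * J) ^ (1 : ℝ)) := by
          rw [Real.rpow_one]; ring
      _ = _ := by
          rw [← Real.rpow_add_of_nonneg hA0 (by linarith) (by norm_num)]
          congr 2; ring
  -- limit
  set sn : ℕ → Set ℝ := fun n => Ioo (t₀ + b ^ 2 / (n + 2)) τ1 with hsn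
  have hU : (⋃ n, sn n) = Ioo t₀ τ1 := by
    apply Subset.antisymm
    · apply iUnion_subset
      intro n
      apply Ioo_subset_Ioo _ le_rfl
      have : 0 ≤ b ^ 2 / ((n : ℝ) + 2) := by positivity
      linarith
    · intro t ht
      obtain ⟨n, hn⟩ := exists_nat_gt (b ^ 2 / (t - t₀))
      refine mem_iUnion.2 ⟨n, ?_, ht.2⟩
      have h0 : 0 < t - t₀ := by linarith [ht.1]
      rw [div_lt_iff₀ h0] at hn
      have : b ^ 2 / ((n : ℝ) + 2) < t - t₀ := by
        rw [div_lt_iff₀ (by positivity)]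
        nlinarith
      linarith
  have hmono : Monotone sn := by
    intro m n hmn
    apply Ioo_subset_Ioo _ le_rfl
    have : (m : ℝ) ≤ n := by exact_mod_cast hmn
    gcongr
  have hlim := tendsto_setIntegral_of_monotone (μ := volume) (s := sn)
    (f := fun t => ∫ x in ball x₀ b, (u x t + l) ^ (p * γ))
    (fun n => measurableSet_Ioo) hmono (by rw [hU]; exact hJi')
  rw [hU] at hlim
  refine le_of_tendsto hlim (Filter.Eventually.of_forall fun n => ?_)
  apply main
  · have : 0 < b ^ 2 / ((n : ℝ) + 2) := by positivity
    linarith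
  · have : b ^ 2 / ((n : ℝ) + 2) < b ^ 2 := by
      apply div_lt_self hb2
      have : (0 : ℝ) ≤ n := Nat.cast_nonneg _
      linarith
    linarith

theorem aux_vol {N : ℕ} (x₀ : E N) (t₀ : ℝ) {a : ℝ} (ha : 0 < a) :
    volume.real (ball x₀ a ×ˢ Ioo t₀ (t₀ + a ^ 2)) =
      volume.real (ball (0 : E N) 1) * a ^ (N + 2) := by
  rw [Measure.volume_eq_prod, measureReal_prod_prod, Real.volume_real_Ioo_of_le (by nlinarith)]
  have h : volume.real (ball x₀ a) = a ^ N * volume.real (ball (0 : E N) 1) := by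
    rw [Measure.real, Measure.addHaar_ball_of_pos volume x₀ ha, ENNReal.toReal_mul,
      ENNReal.toReal_ofReal (by positivity), finrank_euclideanSpace_fin, Measure.real]
  rw [h]
  ring

theorem aux_CA {N : ℕ} {s Λ p m r σ σ' : ℝ} (hΛ : 1 ≤ Λ) (hp1 : p < 1)
    (hm : (1 - p)⁻¹ ≤ m) (hr : 0 < r) (h1 : 1 / 2 ≤ σ') (h2 : σ' < σ) (h3 : σ ≤ 1) :
    CE N s Λ p (cST / (σ * r - σ' * r)) r + cST / (((σ * r) ^ 2 - (σ' * r) ^ 2) / 2) ≤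
      (4 * m * cST ^ 2 + 2 * Λ * (m * cST ^ 2 * CK N s + 2 ^ (N + 2)) + 2 * cST) *
        ((σ - σ') ^ 2 * r ^ 2)⁻¹ := by
  have hd : 0 < σ - σ' := by linarith
  have hq : 0 < 1 - p := by linarith
  have hc := cST_one
  have hck := CK_nonneg N s
  have hm0 : 0 < (1 - p)⁻¹ := by positivity
  have hD : 0 < (σ - σ') ^ 2 * r ^ 2 := by positivity
  set D := (σ - σ') ^ 2 * r ^ 2 with hDd
  have e1 : (cST / (σ * r - σ' * r)) ^ 2 = cST ^ 2 * D⁻¹ := by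
    rw [← sub_mul, div_pow, mul_pow]; rfl
  have e2 : (2 : ℝ) ^ (N + 2) / r ^ 2 ≤ 2 ^ (N + 2) * D⁻¹ := by
    rw [div_eq_mul_inv]
    gcongr
    rw [hDd]
    have : (σ - σ') ^ 2 ≤ 1 := pow_le_one₀ hd.le (by linarith)
    nlinarith [sq_nonneg r]
  have e3 : cST / (((σ * r) ^ 2 - (σ' * r) ^ 2) / 2) ≤ 2 * cST * D⁻¹ := by
    have h : D ≤ (σ * r) ^ 2 - (σ' * r) ^ 2 := by
      rw [hDd]
      have : (σ * r) ^ 2 - (σ' * r) ^ 2 - (σ - σ') ^ 2 * r ^ 2 = 2 * σ' * (σ - σ') * r ^ 2 := by ring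
      have : 0 ≤ 2 * σ' * (σ - σ') * r ^ 2 := by
        have : 0 ≤ σ' := by linarith
        positivity
      linarith
    have h' : cST / (((σ * r) ^ 2 - (σ' * r) ^ 2) / 2) ≤ cST / (D / 2) := by gcongr
    refine h'.trans (le_of_eq ?_)
    field_simp
  unfold CE
  rw [e1, div_eq_mul_inv 4]
  have hDi : 0 < D⁻¹ := by positivity
  have f1 : 4 * (1 - p)⁻¹ * (cST ^ 2 * D⁻¹) ≤ 4 * m * (cST ^ 2 * D⁻¹) := by gcongr
  have f2 : 2 * Λ * ((1 - p)⁻¹ * (cST ^ 2 * D⁻¹) * CK N s + 2 ^ (N + 2) / r ^ 2) ≤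
      2 * Λ * (m * (cST ^ 2 * D⁻¹) * CK N s + 2 ^ (N + 2) * D⁻¹) := by gcongr
  calc _ ≤ 4 * m * (cST ^ 2 * D⁻¹) + 2 * Λ * (m * (cST ^ 2 * D⁻¹) * CK N s + 2 ^ (N + 2) * D⁻¹)
        + 2 * cST * D⁻¹ := add_le_add (add_le_add f1 f2) e3
    _ = _ := by ring

/-- rescaled average -/
def avgQ (N : ℕ) (u : E N → ℝ → ℝ) (x₀ : E N) (r t₀ l η p : ℝ) : ℝ :=
  ⨍ z in (Metric.ball x₀ (η * r)) ×ˢ Set.Ioo t₀ (t₀ + (η * r) ^ 2), (u z.1 z.2 + l) ^ p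

theorem aux_step2 (N : ℕ) (hN : 2 ≤ N) (s Λ : ℝ) (hs : s ∈ Set.Ioo (0 : ℝ) 1) (hΛ : 1 ≤ Λ)
    (q : ℝ) (hq0 : 0 < q) (hq : q < 2 - 2 / kappa N) : ∃ C0 : ℝ, 1 ≤ C0 ∧
    ∀ (T : ℝ) (Ω : Set (E N)) (K : E N → E N → ℝ → ℝ) (u : E N → ℝ → ℝ)
      (x₀ : E N) (R r t₀ l : ℝ),
      KernelOK N s Λ T K → IsWeakSupersolution N T K Ω u →
      Metric.ball x₀ R ⊆ Ω → Set.Ioo t₀ (t₀ + r ^ 2) ⊆ Set.Ioo 0 T →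
      (∀ x ∈ Metric.ball x₀ R, ∀ t ∈ Set.Ioo t₀ (t₀ + r ^ 2), 0 ≤ u x t) →
      0 < r → r ≤ 1 → r < R / 2 → 0 < l →
      (r / R) ^ 2 * tailInfty N s (uminus N u) x₀ R t₀ (t₀ + r ^ 2) ≤ l →
      ∀ p σ' σ : ℝ, 0 < p → p ≤ q / (2 - 2 / kappa N) → 1 / 2 ≤ σ' → σ' < σ → σ ≤ 1 →
        avgQ N u x₀ r t₀ l σ' (p * (2 - 2 / kappa N)) ≤
          (C0 * (σ - σ') ^ (-2 : ℝ) * avgQ N u x₀ r t₀ l σ p) ^ (2 - 2 / kappa N) := by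
  obtain ⟨CS, hCS0, hCS⟩ := aux_sob2 N hN
  obtain ⟨hγ1, hγ2, he⟩ := aux_gamma N hN
  have heγ : (2 * N / kappa N - N + 2 : ℝ) + N * (2 - 2 / kappa N) = ((N + 2 : ℕ) : ℝ) := by
    push_cast; ring
  set γ := 2 - 2 / kappa N with hγ
  set e : ℝ := 2 * N / kappa N - N + 2 with hed
  set m := (1 - q / γ)⁻¹ with hm
  have hγ0 : 0 < γ := by linarith
  have hqγ : q / γ < 1 := by rw [div_lt_one hγ0]; exact hq
  have hm0 : 0 < m := by rw [hm]; apply inv_pos.2; linarith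
  have hck := CK_nonneg N s
  have hc := cST_one
  set ω := volume.real (ball (0 : E N) 1) with hω
  have hω0 : 0 < ω := by
    rw [hω, Measure.real]
    exact ENNReal.toReal_pos (measure_ball_pos volume _ one_pos).ne' measure_ball_lt_top.ne
  set cA := 4 * m * cST ^ 2 + 2 * Λ * (m * cST ^ 2 * CK N s + 2 ^ (N + 2)) + 2 * cST with hcA
  have hcA0 : 0 < cA := by positivity
  set C2 := ω⁻¹ * 2 ^ (N + 2) * (CS * m) * (cA * ω) ^ γ with hC2
  have hC20 : 0 < C2 := by positivity
  refine ⟨max 1 (C2 ^ (1 / γ)), le_max_left _ _, ?_⟩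
  intro T Ω K u x₀ R r t₀ l hK hu hBR hI hu0 hr hr1 hrR hl htail p σ' σ hp hpq h1 h2 h3
  obtain ⟨hum, ⟨M₀, hub⟩, -, -⟩ := id hu
  have hp1 : p < 1 := by linarith
  have hσ'0 : 0 < σ' := by linarith
  have hσ0 : 0 < σ := by linarith
  have hb : 0 < σ' * r := by positivity
  have hba : σ' * r < σ * r := by gcongr
  have hae : σ * r ≤ r := by nlinarith
  have hd : 0 < σ - σ' := by linarith
  have hmp : (1 - p)⁻¹ ≤ m := by
    rw [hm]
    apply inv_anti₀ (by linarith); linarith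
  have hS := aux_step1 N hN s hs hΛ hK hu hBR hI hu0 hr hr1 hrR hl htail hCS0 hCS hp hp1 hb hba hae
  rw [← hγ, ← hed] at hS
  obtain ⟨-, -, i1⟩ := aux_wint (α := p) hum hub hI hu0 hrR hl (hb.trans hba) hae hp.le
  obtain ⟨-, -, i2⟩ := aux_wint (α := p * γ) hum hub hI hu0 hrR hl hb (hba.le.trans hae)
    (by positivity)
  rw [← i1, ← i2] at hS
  have hCA := aux_CA (N := N) (s := s) hΛ hp1 hmp hr h1 h2 h3
  rw [← hcA] at hCA
  unfold avgQ
  rw [setAverage_eq, setAverage_eq, aux_vol x₀ t₀ hb, aux_vol x₀ t₀ (hb.trans hba), ← hω,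
    smul_eq_mul, smul_eq_mul]
  set J := ∫ z in ball x₀ (σ * r) ×ˢ Ioo t₀ (t₀ + (σ * r) ^ 2), (u z.1 z.2 + l) ^ p with hJ
  set J' := ∫ z in ball x₀ (σ' * r) ×ˢ Ioo t₀ (t₀ + (σ' * r) ^ 2), (u z.1 z.2 + l) ^ (p * γ) with hJ'
  have hJ0 : 0 ≤ J := by
    apply setIntegral_nonneg (measurableSet_ball.prod measurableSet_Ioo)
    intro z hz
    apply Real.rpow_nonneg
    have hsq : (σ * r) ^ 2 ≤ r ^ 2 := by gcongr
    have := hu0 z.1 (ball_subset_ball (by linarith) hz.1) z.2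
      (Ioo_subset_Ioo le_rfl (by linarith) hz.2)
    linarith
  set A := (ω * (σ * r) ^ (N + 2))⁻¹ * J with hA
  have hA0 : 0 ≤ A := by positivity
  have hJA : J = ω * (σ * r) ^ (N + 2) * A := by
    rw [hA]; field_simp
  set D := (σ - σ') ^ (-2 : ℝ) with hD
  have hDe : D = ((σ - σ') ^ 2)⁻¹ := by
    rw [hD, Real.rpow_neg hd.le]; norm_cast
  have hD0 : 0 < D := by rw [hDe]; positivity
  have hinner : (CE N s Λ p (cST / (σ * r - σ' * r)) r +
      cST / (((σ * r) ^ 2 - (σ' * r) ^ 2) / 2)) * J ≤ cA * ω * (D * A) * r ^ N := by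
    calc _ ≤ cA * ((σ - σ') ^ 2 * r ^ 2)⁻¹ * J := by gcongr
      _ = cA * ((σ - σ') ^ 2 * r ^ 2)⁻¹ * (ω * (σ ^ (N + 2) * r ^ (N + 2)) * A) := by
          rw [hJA, mul_pow]
      _ ≤ cA * ((σ - σ') ^ 2 * r ^ 2)⁻¹ * (ω * (1 * r ^ (N + 2)) * A) := by
          gcongr
          exact pow_le_one₀ hσ0.le h3
      _ = _ := by
          rw [hDe]; field_simp; ring
  have hinner0 : 0 ≤ (CE N s Λ p (cST / (σ * r - σ' * r)) r +
      cST / (((σ * r) ^ 2 - (σ' * r) ^ 2) / 2)) * J := by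
    have hp1' : 0 < 1 - p := by linarith
    have : 0 < ((σ * r) ^ 2 - (σ' * r) ^ 2) / 2 := by
      have : (σ' * r) ^ 2 < (σ * r) ^ 2 := by gcongr
      linarith
    unfold CE; positivity
  have hpw : r ^ e * (r ^ N) ^ γ = r ^ (N + 2) := by
    rw [← Real.rpow_natCast r N, ← Real.rpow_mul hr.le, ← Real.rpow_add hr, heγ, Real.rpow_natCast]
  have hS2 : J' ≤ CS * m * (cA * ω) ^ γ * (D * A) ^ γ * r ^ (N + 2) := by
    calc J' ≤ _ := hS
      _ ≤ CS * r ^ e * m * (cA * ω * (D * A) * r ^ N) ^ γ := by gcongr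
      _ = CS * m * (cA * ω) ^ γ * (D * A) ^ γ * (r ^ e * (r ^ N) ^ γ) := by
          rw [Real.mul_rpow (by positivity) (by positivity),
            Real.mul_rpow (by positivity) (by positivity)]
          ring
      _ = _ := by rw [hpw]
  have hV : (ω * (σ' * r) ^ (N + 2))⁻¹ ≤ ω⁻¹ * 2 ^ (N + 2) * (r ^ (N + 2))⁻¹ := by
    have : ω⁻¹ * 2 ^ (N + 2) * (r ^ (N + 2))⁻¹ = (ω * (1 / 2 * r) ^ (N + 2))⁻¹ := by
      rw [mul_pow, mul_inv, mul_inv, one_div, inv_pow, inv_inv]; ring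
    rw [this]
    gcongr
  calc (ω * (σ' * r) ^ (N + 2))⁻¹ * J' ≤ (ω * (σ' * r) ^ (N + 2))⁻¹ *
        (CS * m * (cA * ω) ^ γ * (D * A) ^ γ * r ^ (N + 2)) := by gcongr
    _ ≤ ω⁻¹ * 2 ^ (N + 2) * (r ^ (N + 2))⁻¹ *
        (CS * m * (cA * ω) ^ γ * (D * A) ^ γ * r ^ (N + 2)) := by gcongr
    _ = C2 * (D * A) ^ γ := by rw [hC2]; field_simp
    _ = (C2 ^ (1 / γ)) ^ γ * (D * A) ^ γ := by
        rw [← Real.rpow_mul hC20.le, one_div_mul_cancel hγ0.ne', Real.rpow_one]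
    _ ≤ (max 1 (C2 ^ (1 / γ))) ^ γ * (D * A) ^ γ := by
        gcongr
        exact le_max_right _ _
    _ = _ := by
        rw [← Real.mul_rpow (by positivity) (by positivity)]
        congr 1; ring

theorem aux_const {γ C0 : ℝ} (hγ : 1 < γ) (hC0 : 1 ≤ C0) : ∃ C1 : ℝ, 1 ≤ C1 ∧ C0 ≤ C1 ∧
    ∀ δ : ℝ, 0 < δ → (C1 * (δ / 2) ^ (-(2 * γ / (γ - 1)))) ^ (1 / γ) * (C0 * (δ / 2) ^ (-2 : ℝ)) ≤
      C1 * δ ^ (-(2 * γ / (γ - 1))) := by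
  have hg : 0 < γ - 1 := by linarith
  have hγ0 : 0 < γ := by linarith
  set θ := 2 * γ / (γ - 1) with hθ
  have hθ0 : 0 < θ := by positivity
  set B := 2 ^ (θ / γ) * 2 ^ (2 : ℝ) * C0 with hB
  have h2 : (1 : ℝ) ≤ 2 ^ (θ / γ) := Real.one_le_rpow (by norm_num) (by positivity)
  have h3 : (1 : ℝ) ≤ 2 ^ (2 : ℝ) := Real.one_le_rpow (by norm_num) (by norm_num)
  have hBC : C0 ≤ B := by
    rw [hB]
    have : (1 : ℝ) ≤ 2 ^ (θ / γ) * 2 ^ (2 : ℝ) := by nlinarith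
    nlinarith
  have hB1 : 1 ≤ B := hC0.trans hBC
  have hB0 : 0 < B := by linarith
  have hexp : 1 ≤ γ / (γ - 1) := by rw [le_div_iff₀ hg]; linarith
  have hBC1 : B ≤ B ^ (γ / (γ - 1)) := by
    calc B = B ^ (1 : ℝ) := (Real.rpow_one B).symm
      _ ≤ _ := Real.rpow_le_rpow_of_exponent_le hB1 hexp
  refine ⟨B ^ (γ / (γ - 1)), hB1.trans hBC1, hBC.trans hBC1, ?_⟩
  intro δ hδ
  apply le_of_eq
  have hC0p : 0 < C0 := by linarith
  rw [Real.div_rpow hδ.le (by norm_num), Real.div_rpow hδ.le (by norm_num),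
    Real.mul_rpow (by positivity) (by positivity), Real.div_rpow (by positivity) (by positivity),
    ← Real.rpow_mul hB0.le, ← Real.rpow_mul hδ.le, ← Real.rpow_mul (by norm_num : (0 : ℝ) ≤ 2)]
  have e1 : δ ^ (-θ * (1 / γ)) * δ ^ (-2 : ℝ) = δ ^ (-θ) := by
    rw [← Real.rpow_add hδ]
    congr 1
    rw [hθ]; field_simp; ring
  have e2 : B ^ (γ / (γ - 1) * (1 / γ)) * B = B ^ (γ / (γ - 1)) := by
    nth_rewrite 2 [← Real.rpow_one B]
    rw [← Real.rpow_add hB0]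
    congr 1
    field_simp; ring
  have e3 : (2 : ℝ) ^ (-θ * (1 / γ)) = (2 ^ (θ / γ))⁻¹ := by
    rw [← Real.rpow_neg (by norm_num)]
    congr 1; ring
  have e4 : (2 : ℝ) ^ (-2 : ℝ) = (2 ^ (2 : ℝ))⁻¹ := Real.rpow_neg (by norm_num) _
  rw [e3, e4, ← e1, ← e2]
  calc _ = B ^ (γ / (γ - 1) * (1 / γ)) * (2 ^ (θ / γ) * 2 ^ (2 : ℝ) * C0) *
        (δ ^ (-θ * (1 / γ)) * δ ^ (-2 : ℝ)) := by
          rw [div_inv_eq_mul, div_inv_eq_mul]; ring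
    _ = _ := by rw [← hB]

theorem aux_iter {γ C0 C1 q : ℝ} (hγ : 1 < γ) (hγ2 : γ < 2) (hC0 : 1 ≤ C0) (hC1 : C0 ≤ C1)
    (hq0 : 0 < q)
    (hC : ∀ δ : ℝ, 0 < δ → (C1 * (δ / 2) ^ (-(2 * γ / (γ - 1)))) ^ (1 / γ) *
      (C0 * (δ / 2) ^ (-2 : ℝ)) ≤ C1 * δ ^ (-(2 * γ / (γ - 1))))
    {A : ℝ → ℝ → ℝ} (hA : ∀ η p, 1 / 2 ≤ η → η ≤ 1 → 0 < p → 0 ≤ A η p)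
    (hstep : ∀ p σ' σ : ℝ, 0 < p → p ≤ q / γ → 1 / 2 ≤ σ' → σ' < σ → σ ≤ 1 →
      A σ' (p * γ) ≤ (C0 * (σ - σ') ^ (-2 : ℝ) * A σ p) ^ γ) (n : ℕ) :
    ∀ σ' σ : ℝ, 1 / 2 ≤ σ' → σ' < σ → σ ≤ 1 →
      A σ' q ^ (1 / q) ≤ (C1 * (σ - σ') ^ (-(2 * γ / (γ - 1)))) ^ (1 / (q / γ ^ (n + 1))) *
        A σ (q / γ ^ (n + 1)) ^ (1 / (q / γ ^ (n + 1))) := by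
  have hg : 0 < γ - 1 := by linarith
  have hγ0 : 0 < γ := by linarith
  have hC00 : 0 < C0 := by linarith
  have hC10 : 0 < C1 := by linarith
  have hs : ∀ p σ' σ : ℝ, 0 < p → p ≤ q / γ → 1 / 2 ≤ σ' → σ' < σ → σ ≤ 1 →
      A σ' (p * γ) ^ (1 / (p * γ)) ≤ (C0 * (σ - σ') ^ (-2 : ℝ) * A σ p) ^ (1 / p) := by
    intro p σ' σ hp hpq h1 h2 h3
    have hd : 0 < σ - σ' := by linarith
    have := Real.rpow_le_rpow (hA _ _ h1 (by linarith) (by positivity)) (hstep p σ' σ hp hpq h1 h2 h3)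
      (show 0 ≤ 1 / (p * γ) by positivity)
    refine this.trans (le_of_eq ?_)
    have hA' := hA σ p (by linarith) h3 hp
    rw [← Real.rpow_mul (by positivity)]
    congr 1; field_simp
  induction n with
  | zero =>
    intro σ' σ h1 h2 h3
    have hd : 0 < σ - σ' := by linarith
    have := hs (q / γ) σ' σ (by positivity) le_rfl h1 h2 h3
    rw [div_mul_cancel₀ _ hγ0.ne'] at this
    simp only [zero_add, pow_one]
    have hA' := hA σ (q / γ) (by linarith) h3 (by positivity)
    refine this.trans ?_
    rw [← Real.mul_rpow (by positivity) hA']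
    apply Real.rpow_le_rpow (by positivity) _ (by positivity)
    have : (σ - σ') ^ (-2 : ℝ) ≤ (σ - σ') ^ (-(2 * γ / (γ - 1))) := by
      apply Real.rpow_le_rpow_of_exponent_ge hd (by linarith)
      apply neg_le_neg
      rw [le_div_iff₀ hg]; linarith
    gcongr
  | succ n ih =>
    intro σ' σ h1 h2 h3
    have hd : 0 < σ - σ' := by linarith
    set p := q / γ ^ (n + 1) with hp
    set p' := q / γ ^ (n + 1 + 1) with hp'
    have hp0 : 0 < p := by positivity
    have hp0' : 0 < p' := by positivity
    have hpp : p' * γ = p := by rw [hp, hp', pow_succ γ (n + 1)]; field_simp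
    have hle : p' ≤ q / γ := by
      rw [hp']
      have : γ ^ 1 ≤ γ ^ (n + 1 + 1) := pow_le_pow_right₀ hγ.le (by omega)
      rw [pow_one] at this
      gcongr
    set ρ := (σ + σ') / 2 with hρ
    have a1 := ih σ' ρ h1 (by rw [hρ]; linarith) (by rw [hρ]; linarith)
    have a2 := hs p' ρ σ hp0' hle (by rw [hρ]; linarith) (by rw [hρ]; linarith) h3
    rw [hpp] at a2
    rw [show ρ - σ' = (σ - σ') / 2 by rw [hρ]; ring] at a1
    rw [show σ - ρ = (σ - σ') / 2 by rw [hρ]; ring] at a2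
    have hA' := hA σ p' (by linarith) h3 hp0'
    set X := C1 * ((σ - σ') / 2) ^ (-(2 * γ / (γ - 1))) with hX
    have hX0 : 0 < X := by positivity
    have hXp : X ^ (1 / p) = (X ^ (1 / γ)) ^ (1 / p') := by
      rw [← Real.rpow_mul hX0.le, ← hpp]
      congr 1; field_simp
    calc A σ' q ^ (1 / q) ≤ X ^ (1 / p) * A ρ p ^ (1 / p) := a1
      _ ≤ X ^ (1 / p) * (C0 * ((σ - σ') / 2) ^ (-2 : ℝ) * A σ p') ^ (1 / p') := by gcongr
      _ = (X ^ (1 / γ) * (C0 * ((σ - σ') / 2) ^ (-2 : ℝ))) ^ (1 / p') * A σ p' ^ (1 / p') := by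
          rw [hXp, Real.mul_rpow (by positivity) hA', Real.mul_rpow (x := X ^ (1 / γ))
            (by positivity) (by positivity)]
          ring
      _ ≤ _ := by
          apply mul_le_mul_of_nonneg_right _ (by positivity)
          exact Real.rpow_le_rpow (by positivity) (hC _ hd) (by positivity)

theorem aux_final {γ C0 C1 q : ℝ} (hγ : 1 < γ) (hγ2 : γ < 2) (hC0 : 1 ≤ C0) (hC1 : C0 ≤ C1)
    (hq0 : 0 < q)
    (hC : ∀ δ : ℝ, 0 < δ → (C1 * (δ / 2) ^ (-(2 * γ / (γ - 1)))) ^ (1 / γ) *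
      (C0 * (δ / 2) ^ (-2 : ℝ)) ≤ C1 * δ ^ (-(2 * γ / (γ - 1))))
    {A : ℝ → ℝ → ℝ} (hA : ∀ η p, 1 / 2 ≤ η → η ≤ 1 → 0 < p → 0 ≤ A η p)
    (hJ : ∀ η p p', 1 / 2 ≤ η → η ≤ 1 → 0 < p → p ≤ p' → A η p ^ (1 / p) ≤ A η p' ^ (1 / p'))
    (hstep : ∀ p σ' σ : ℝ, 0 < p → p ≤ q / γ → 1 / 2 ≤ σ' → σ' < σ → σ ≤ 1 →
      A σ' (p * γ) ≤ (C0 * (σ - σ') ^ (-2 : ℝ) * A σ p) ^ γ)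
    {qb σ' σ : ℝ} (hb0 : 0 < qb) (hbq : qb < q) (h1 : 1 / 2 ≤ σ') (h2 : σ' < σ) (h3 : σ ≤ 1) :
    A σ' q ^ (1 / q) ≤ (C1 ^ γ * (σ - σ') ^ (-(2 * γ / (γ - 1) * γ))) ^ (1 / qb) *
        A σ qb ^ (1 / qb) := by
  have hg : 0 < γ - 1 := by linarith
  have hγ0 : 0 < γ := by linarith
  have hC10 : 0 < C1 := by linarith
  have hd : 0 < σ - σ' := by linarith
  obtain ⟨n, hn1, hn2⟩ := exists_nat_pow_near (x := q / qb) (y := γ)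
    (by rw [le_div_iff₀ hb0]; linarith) hγ
  have key := aux_iter hγ hγ2 hC0 hC1 hq0 hC hA hstep n σ' σ h1 h2 h3
  set p := q / γ ^ (n + 1) with hp
  have hp0 : 0 < p := by positivity
  have hpb : p ≤ qb := by
    rw [hp, div_le_iff₀ (by positivity)]
    rw [div_lt_iff₀ hb0] at hn2
    linarith
  have hinv : 1 / p ≤ γ * (1 / qb) := by
    rw [le_div_iff₀ hb0] at hn1
    rw [hp, one_div_div, pow_succ, div_le_iff₀ hq0, mul_one_div, div_mul_eq_mul_div, le_div_iff₀ hb0]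
    nlinarith
  set X := C1 * (σ - σ') ^ (-(2 * γ / (γ - 1))) with hX
  have hX1 : 1 ≤ X := by
    have : 1 ≤ (σ - σ') ^ (-(2 * γ / (γ - 1))) := by
      apply Real.one_le_rpow_of_pos_of_le_one_of_nonpos hd (by linarith)
      have : 0 ≤ 2 * γ / (γ - 1) := by positivity
      linarith
    rw [hX]; nlinarith
  have hXe : (C1 ^ γ * (σ - σ') ^ (-(2 * γ / (γ - 1) * γ))) = X ^ γ := by
    rw [hX, Real.mul_rpow (by positivity) (by positivity), ← Real.rpow_mul hd.le, neg_mul]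
  rw [hXe, ← Real.rpow_mul (by linarith)]
  have hA' := hA σ qb (by linarith) h3 hb0
  have hA'' := hA σ p (by linarith) h3 hp0
  refine key.trans ?_
  apply mul_le_mul _ (hJ σ p qb (by linarith) h3 hp0 hpb) (by positivity) (by positivity)
  exact Real.rpow_le_rpow_of_exponent_le hX1 hinv

theorem stmt_13 (N : ℕ) (hN : 2 ≤ N) :
    ∃ θ : ℝ, 0 < θ ∧
      ∀ s Λ : ℝ, s ∈ Set.Ioo (0 : ℝ) 1 → 1 ≤ Λ →
        ∀ q : ℝ, 0 < q → q < 2 - 2 / kappa N →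
          ∃ C : ℝ, 0 < C ∧
            ∀ (T : ℝ) (Ω : Set (E N)) (K : E N → E N → ℝ → ℝ) (u : E N → ℝ → ℝ)
              (x₀ : E N) (R r t₀ d l : ℝ),
              0 < T → IsOpen Ω → Bornology.IsBounded Ω →
              KernelOK N s Λ T K → IsWeakSupersolution N T K Ω u →
              Metric.ball x₀ R ⊆ Ω → Set.Ioo t₀ (t₀ + r ^ 2) ⊆ Set.Ioo 0 T →
              (∀ x ∈ Metric.ball x₀ R, ∀ t ∈ Set.Ioo t₀ (t₀ + r ^ 2), 0 ≤ u x t) →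
              0 < r → r ≤ 1 → r < R / 2 → 0 < d →
              (r / R) ^ 2 * tailInfty N s (uminus N u) x₀ R t₀ (t₀ + r ^ 2) + d ≤ l →
              ∀ qb σ' σ : ℝ, 0 < qb → qb < q → 1 / 2 ≤ σ' → σ' < σ → σ ≤ 1 →
                (⨍ p in (Metric.ball x₀ (σ' * r)) ×ˢ Set.Ioo t₀ (t₀ + (σ' * r) ^ 2),
                    (u p.1 p.2 + l) ^ q) ^ (1 / q) ≤
                  (C * (σ - σ') ^ (-θ)) ^ (1 / qb) *
                    (⨍ p in (Metric.ball x₀ (σ * r)) ×ˢ Set.Ioo t₀ (t₀ + (σ * r) ^ 2),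
                      (u p.1 p.2 + l) ^ qb) ^ (1 / qb) := by
  obtain ⟨hγ1, hγ2, -⟩ := aux_gamma N hN
  have hg : 0 < 2 - 2 / kappa N - 1 := by linarith
  have hγ0 : 0 < 2 - 2 / kappa N := by linarith
  refine ⟨2 * (2 - 2 / kappa N) / (2 - 2 / kappa N - 1) * (2 - 2 / kappa N), by positivity, ?_⟩
  intro s Λ hs hΛ q hq0 hq
  obtain ⟨C0, hC0, hstep⟩ := aux_step2 N hN s Λ hs hΛ q hq0 hq
  obtain ⟨C1, hC11, hC1, hC⟩ := aux_const hγ1 hC0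
  refine ⟨C1 ^ (2 - 2 / kappa N), by positivity, ?_⟩
  intro T Ω K u x₀ R r t₀ d l hT hΩ hΩb hK hu hBR hI hu0 hr hr1 hrR hd hl qb σ' σ hb0 hbq h1 h2 h3
  obtain ⟨hum, ⟨M₀, hub⟩, -, -⟩ := id hu
  have htail0 := (aux_tail N hN s hs hum hub hI hu0 hr hrR).1
  have htail1 := mul_nonneg (sq_nonneg (r / R)) htail0
  have hl0 : 0 < l := by linarith
  have hlt : (r / R) ^ 2 * tailInfty N s (uminus N u) x₀ R t₀ (t₀ + r ^ 2) ≤ l := by linarith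
  have hw : ∀ η, 1 / 2 ≤ η → η ≤ 1 → ∀ z ∈ ball x₀ (η * r) ×ˢ Ioo t₀ (t₀ + (η * r) ^ 2),
      0 < u z.1 z.2 + l := by
    intro η e1 e2 z hz
    have hηr : η * r ≤ r := by nlinarith
    have hη0 : 0 ≤ η * r := by nlinarith
    have hsq : (η * r) ^ 2 ≤ r ^ 2 := by gcongr
    have := hu0 z.1 (ball_subset_ball (by linarith) hz.1) z.2
      (Ioo_subset_Ioo le_rfl (by linarith) hz.2)
    linarith
  have hA : ∀ η p, 1 / 2 ≤ η → η ≤ 1 → 0 < p → 0 ≤ avgQ N u x₀ r t₀ l η p := by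
    intro η p e1 e2 hp
    unfold avgQ
    rw [setAverage_eq]
    apply smul_nonneg (by positivity)
    apply setIntegral_nonneg (measurableSet_ball.prod measurableSet_Ioo)
    intro z hz
    exact Real.rpow_nonneg (hw η e1 e2 z hz).le _
  have hJ : ∀ η p p', 1 / 2 ≤ η → η ≤ 1 → 0 < p → p ≤ p' →
      avgQ N u x₀ r t₀ l η p ^ (1 / p) ≤ avgQ N u x₀ r t₀ l η p' ^ (1 / p') := by
    intro η p p' e1 e2 hp hpp
    have hp' : 0 < p' := by linarith
    have hηr : η * r ≤ r := by nlinarith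
    have hη0 : 0 < η * r := by nlinarith
    have hms : MeasurableSet (ball x₀ (η * r) ×ˢ Ioo t₀ (t₀ + (η * r) ^ 2)) :=
      measurableSet_ball.prod measurableSet_Ioo
    obtain ⟨i1, -, -⟩ := aux_wint (α := p) hum hub hI hu0 hrR hl0 hη0 hηr hp.le
    obtain ⟨i2, -, -⟩ := aux_wint (α := p') hum hub hI hu0 hrR hl0 hη0 hηr hp'.le
    have hcomp : ∀ z ∈ ball x₀ (η * r) ×ˢ Ioo t₀ (t₀ + (η * r) ^ 2),
        ((u z.1 z.2 + l) ^ p) ^ (p' / p) = (u z.1 z.2 + l) ^ p' := by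
      intro z hz
      rw [← Real.rpow_mul (hw η e1 e2 z hz).le]
      congr 1; field_simp
    have hv0 : volume.real (ball x₀ (η * r) ×ˢ Ioo t₀ (t₀ + (η * r) ^ 2)) ≠ 0 := by
      rw [aux_vol x₀ t₀ hη0]
      have : 0 < volume.real (ball (0 : E N) 1) := by
        rw [Measure.real]
        exact ENNReal.toReal_pos (measure_ball_pos volume _ one_pos).ne' measure_ball_lt_top.ne
      positivity
    have hv := ENNReal.toReal_ne_zero.1 hv0
    have key := ConvexOn.map_set_average_le (μ := volume)
      (convexOn_rpow (show 1 ≤ p' / p by rw [le_div_iff₀ hp]; linarith))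
      (Real.continuous_rpow_const (show 0 ≤ p' / p by positivity)).continuousOn isClosed_Ici
      hv.1 hv.2
      (f := fun z : E N × ℝ => (u z.1 z.2 + l) ^ p)
      ((ae_restrict_iff' hms).2 (Filter.Eventually.of_forall fun z hz =>
        Real.rpow_nonneg (hw η e1 e2 z hz).le _)) i1
      (i2.congr_fun (fun z hz => (hcomp z hz).symm) hms)
    have e : (⨍ z in ball x₀ (η * r) ×ˢ Ioo t₀ (t₀ + (η * r) ^ 2),
        ((u z.1 z.2 + l) ^ p) ^ (p' / p)) = avgQ N u x₀ r t₀ l η p' := by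
      unfold avgQ
      rw [setAverage_eq, setAverage_eq, setIntegral_congr_fun hms hcomp]
    rw [e] at key
    have key' : avgQ N u x₀ r t₀ l η p ^ (p' / p) ≤ avgQ N u x₀ r t₀ l η p' := key
    have h0 := hA η p e1 e2 hp
    calc avgQ N u x₀ r t₀ l η p ^ (1 / p) = (avgQ N u x₀ r t₀ l η p ^ (p' / p)) ^ (1 / p') := by
          rw [← Real.rpow_mul h0]
          congr 1; field_simp
      _ ≤ _ := Real.rpow_le_rpow (by positivity) key' (by positivity)
  exact aux_final hγ1 hγ2 hC0 hC1 hq0 hC hA hJ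
    (hstep T Ω K u x₀ R r t₀ l hK hu hBR hI hu0 hr hr1 hrR hl0 hlt) hb0 hbq h1 h2 h3
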